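/- arXiv:1910.07228 — 4 statements merged into one kernel-verified Lean document; each statement's English description precedes it below -/
import Mathlib

section
/- In the soliton matrix setup, let ξ, η ∈ ℂ with ξ ≠ η be such that L₁ ± ξ, L₂ ± ξ, L₁ ± η, L₂ ± η are all invertible, 1 − β₁ζℓ₁ ≠ 0 and 1 − β₂ζℓ₂ ≠ 0 for ζ ∈ {ξ, η}, and such that 1 + A₁^ξA₂^ξ, 1 + A₁^ηA₂^η and 1 + A₁^{ξη}A₂^{ξη} are invertible. Set f = τ^ξ·τ^η/(τ·τ^{ξη}). Then the Moutard-type two-shift relations hold: p^{ξη} − p + ξ + η = ((ξ+η)/(ξ−η))·f·(p^ξ − p^η + ξ − η); q^{ξη} − q = ((ξ+η)/(ξ−η))·f·(q^ξ − q^η); r^{ξη} − r = ((ξ+η)/(ξ−η))·f·(r^ξ − r^η), where X^ζ and X^{ξη} denote the values of X computed from the correspondingly shifted matrices. -/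
open Matrix

noncomputable section

/-! Soliton matrix setup (Vekslerchik, "Solitons of the vector KdV and Yamilov lattices").
We work with `N × N` complex matrices.  `Dg l` is the diagonal matrix with entries `l`.
The `ζ`-shift acts by `A₁ ↦ A₁(L₁ + ζ)(L₁ − ζ)⁻¹`, `A₂ ↦ A₂(L₂ − ζ)(L₂ + ζ)⁻¹`;
all derived quantities (`tauD`, `G₁D`, `pD`, …) are functions of the pair `(A₁, A₂)`,
so their shifted values are obtained by evaluating them on the shifted matrices. -/

/-- `N × N` complex matrices. -/
abbrev Mat (N : ℕ) := Matrix (Fin N) (Fin N) ℂ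

variable {N : ℕ}

/-- the diagonal matrix built from `l`. -/
def Dg (l : Fin N → ℂ) : Mat N := Matrix.diagonal l

/-- the `ζ`-shift of `A₁`: `A₁(L₁ + ζ)(L₁ − ζ)⁻¹`. -/
def shA₁ (l₁ : Fin N → ℂ) (ζ : ℂ) (A₁ : Mat N) : Mat N :=
  A₁ * (Dg l₁ + ζ • 1) * (Dg l₁ - ζ • 1)⁻¹

/-- the `ζ`-shift of `A₂`: `A₂(L₂ − ζ)(L₂ + ζ)⁻¹`. -/
def shA₂ (l₂ : Fin N → ℂ) (ζ : ℂ) (A₂ : Mat N) : Mat N :=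
  A₂ * (Dg l₂ - ζ • 1) * (Dg l₂ + ζ • 1)⁻¹

/-- the tau-function `τ = det(1 + A₁A₂)`. -/
def tauD (A₁ A₂ : Mat N) : ℂ := (1 + A₁ * A₂).det

/-- `G₁ = (1 + A₁A₂)⁻¹`. -/
def G₁D (A₁ A₂ : Mat N) : Mat N := (1 + A₁ * A₂)⁻¹

/-- `G₂ = (1 + A₂A₁)⁻¹`. -/
def G₂D (A₁ A₂ : Mat N) : Mat N := (1 + A₂ * A₁)⁻¹

/-- `p = 1 − β₁G₁ℓ₁`. -/
def pD (β₁ ℓ₁ : Fin N → ℂ) (A₁ A₂ : Mat N) : ℂ := 1 - β₁ ⬝ᵥ (G₁D A₁ A₂ *ᵥ ℓ₁)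

/-- `q = β₁G₁A₁ℓ₂`. -/
def qD (β₁ ℓ₂ : Fin N → ℂ) (A₁ A₂ : Mat N) : ℂ := β₁ ⬝ᵥ (G₁D A₁ A₂ *ᵥ (A₁ *ᵥ ℓ₂))

/-- `r = β₂G₂A₂ℓ₁`. -/
def rD (β₂ ℓ₁ : Fin N → ℂ) (A₁ A₂ : Mat N) : ℂ := β₂ ⬝ᵥ (G₂D A₁ A₂ *ᵥ (A₂ *ᵥ ℓ₁))

/-- `s = 1 − β₂G₂ℓ₂`. -/
def sD (β₂ ℓ₂ : Fin N → ℂ) (A₁ A₂ : Mat N) : ℂ := 1 - β₂ ⬝ᵥ (G₂D A₁ A₂ *ᵥ ℓ₂)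

/-- the row `β₁ζ = β₁(L₂ − ζ)⁻¹`. -/
def β₁z (l₂ β₁ : Fin N → ℂ) (ζ : ℂ) : Fin N → ℂ := β₁ ᵥ* (Dg l₂ - ζ • 1)⁻¹

/-- the row `β₂ζ = β₂(L₁ + ζ)⁻¹`. -/
def β₂z (l₁ β₂ : Fin N → ℂ) (ζ : ℂ) : Fin N → ℂ := β₂ ᵥ* (Dg l₁ + ζ • 1)⁻¹

/-- the column `ℓ₁ζ = (L₂ + ζ)⁻¹ℓ₁`. -/
def ℓ₁z (l₂ ℓ₁ : Fin N → ℂ) (ζ : ℂ) : Fin N → ℂ := (Dg l₂ + ζ • 1)⁻¹ *ᵥ ℓ₁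

/-- the column `ℓ₂ζ = (L₁ − ζ)⁻¹ℓ₂`. -/
def ℓ₂z (l₁ ℓ₂ : Fin N → ℂ) (ζ : ℂ) : Fin N → ℂ := (Dg l₁ - ζ • 1)⁻¹ *ᵥ ℓ₂

/-- `K₁ζ = (1 − β₁ζℓ₁)⁻¹`. -/
def K₁z (l₂ β₁ ℓ₁ : Fin N → ℂ) (ζ : ℂ) : ℂ := (1 - β₁z l₂ β₁ ζ ⬝ᵥ ℓ₁)⁻¹

/-- `K₂ζ = (1 − β₂ζℓ₂)⁻¹`. -/
def K₂z (l₁ β₂ ℓ₂ : Fin N → ℂ) (ζ : ℂ) : ℂ := (1 - β₂z l₁ β₂ ζ ⬝ᵥ ℓ₂)⁻¹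

/-- `K_ζ = K₁ζ K₂ζ`. -/
def Kz (l₁ l₂ β₁ β₂ ℓ₁ ℓ₂ : Fin N → ℂ) (ζ : ℂ) : ℂ :=
  K₁z l₂ β₁ ℓ₁ ζ * K₂z l₁ β₂ ℓ₂ ζ

/-- `p_ζ = 1 − β₁ζG₁ℓ₁` (the `G`'s computed from the given pair `(A₁, A₂)`). -/
def pz (l₂ β₁ ℓ₁ : Fin N → ℂ) (ζ : ℂ) (A₁ A₂ : Mat N) : ℂ :=
  1 - β₁z l₂ β₁ ζ ⬝ᵥ (G₁D A₁ A₂ *ᵥ ℓ₁)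

/-- `q_ζ = β₁ζG₁A₁ℓ₂`. -/
def qz (l₂ β₁ ℓ₂ : Fin N → ℂ) (ζ : ℂ) (A₁ A₂ : Mat N) : ℂ :=
  β₁z l₂ β₁ ζ ⬝ᵥ (G₁D A₁ A₂ *ᵥ (A₁ *ᵥ ℓ₂))

/-- `r_ζ = β₂ζG₂A₂ℓ₁`. -/
def rz (l₁ β₂ ℓ₁ : Fin N → ℂ) (ζ : ℂ) (A₁ A₂ : Mat N) : ℂ :=
  β₂z l₁ β₂ ζ ⬝ᵥ (G₂D A₁ A₂ *ᵥ (A₂ *ᵥ ℓ₁))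

/-- `s_ζ = 1 − β₂ζG₂ℓ₂`. -/
def sz (l₁ β₂ ℓ₂ : Fin N → ℂ) (ζ : ℂ) (A₁ A₂ : Mat N) : ℂ :=
  1 - β₂z l₁ β₂ ζ ⬝ᵥ (G₂D A₁ A₂ *ᵥ ℓ₂)

end

section MoutardAux
variable {n m : Type*} [Fintype n] [DecidableEq n] [Fintype m] [DecidableEq m]

lemma aux_key (L S A A' B D : Matrix n n ℂ) (z : ℂ) (hD : D = L + z • S)
    (hAL : A * L = L * A - B * A) (hAS : A * S = -(S * A))
    (hA' : A' * D = A * (L - z • S)) : (1 + A') * D = D * (1 + A) - B * A := by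
  rw [add_mul, hA', mul_sub, hAL, Matrix.mul_smul, hAS, hD]
  simp only [add_mul, mul_add, Matrix.smul_mul, one_mul, mul_one, smul_neg]
  abel

lemma aux_step (L S A A' B G G' D : Matrix n n ℂ) (z : ℂ) (hD : D = L + z • S)
    (hAL : A * L = L * A - B * A) (hAS : A * S = -(S * A))
    (hA' : A' * D = A * (L - z • S)) (hG : (1 + A) * G = 1) (hG' : G' * (1 + A') = 1) :
    G' * D - D * G = G' * B * (1 - G) := by
  have key := aux_key L S A A' B D z hD hAL hAS hA'
  have e : A * G = 1 - G := by rw [← hG]; noncomm_ring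
  have e2 : D * G = G' * (((1 + A') * D) * G) := by
    rw [← mul_assoc, ← mul_assoc, hG', one_mul]
  rw [e2, key, ← e]
  have e3 : (D * (1 + A) - B * A) * G = D * ((1 + A) * G) - B * (A * G) := by noncomm_ring
  rw [e3, hG]
  noncomm_ring

lemma aux_det (L S A A' G D Di : Matrix n n ℂ) (U : Matrix n m ℂ) (V : Matrix m n ℂ)
    (z : ℂ) (hD : D = L + z • S)
    (hAL : A * L = L * A - (U * V) * A) (hAS : A * S = -(S * A))
    (hA' : A' * D = A * (L - z • S)) (hG : G * (1 + A) = 1) (hDi : D * Di = 1) :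
    (1 + A').det = (1 + A).det * (1 - V * (1 - G) * Di * U).det := by
  have key := aux_key L S A A' (U * V) D z hD hAL hAS hA'
  have e : (1 - G) * (1 + A) = A := by rw [sub_mul, hG]; noncomm_ring
  have e1 : 1 + A' = D * (1 - Di * U * (V * (1 - G))) * (1 + A) * Di := by
    have : D * (1 - Di * U * (V * (1 - G))) * (1 + A)
        = D * (1 + A) - (D * Di) * (U * V) * ((1 - G) * (1 + A)) := by
      simp only [Matrix.mul_assoc, mul_sub, sub_mul, one_mul, mul_one, Matrix.mul_sub, Matrix.sub_mul, Matrix.one_mul, Matrix.mul_one]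
    rw [this, hDi, e, one_mul, ← key, mul_assoc, hDi, mul_one]
  rw [e1, Matrix.det_mul, Matrix.det_mul, Matrix.det_mul]
  have e2 : D.det * Di.det = 1 := by rw [← Matrix.det_mul, hDi, Matrix.det_one]
  have e3 : (1 - Di * U * (V * (1 - G))).det = (1 - V * (1 - G) * Di * U).det := by
    rw [Matrix.det_one_sub_mul_comm, Matrix.mul_assoc (V * (1 - G))]
  rw [e3]
  linear_combination ((1 + A).det * (1 - V * (1 - G) * Di * U).det) * e2

lemma aux_E1 (G G' D Di : Matrix n n ℂ) (U : Matrix n m ℂ) (V : Matrix m n ℂ)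
    (hs : G' * D - D * G = G' * (U * V) * (1 - G)) (hDi : D * Di = 1) :
    V * G' * U * (1 - V * (1 - G) * Di * U) = V * D * G * Di * U := by
  have h := congrArg (fun X => V * (X * (Di * U))) hs
  have e : G' * D * (Di * U) = G' * U := by
    rw [← Matrix.mul_assoc, Matrix.mul_assoc G', hDi, Matrix.mul_one]
  simp only [Matrix.sub_mul, e] at h
  have h2 : V * G' * U - V * D * G * Di * U = V * G' * U * (V * (1 - G) * Di * U) := by
    simpa only [Matrix.mul_assoc, Matrix.mul_sub, Matrix.sub_mul] using h
  rw [Matrix.mul_sub, Matrix.mul_one, ← h2]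
  abel

lemma aux_shift (L S G G' D Di : Matrix n n ℂ) (U : Matrix n m ℂ) (V : Matrix m n ℂ)
    (s M : Matrix m m ℂ) (z : ℂ) (hD : D = L + z • S)
    (hs : G' * D - D * G = G' * (U * V) * (1 - G))
    (hc : G * L - L * G = G * (U * V) * (1 - G))
    (hDi : D * Di = 1) (hSD : S * Di = Di * S) (hV : V * S = s * V) (hU : S * U = U * s)
    (hM : M = 1 - V * (1 - G) * Di * U) :
    (V * G' * U - V * G * U - z • s) * M = -(z • (M * s)) := by
  have h1 := aux_E1 G G' D Di U V hs hDi
  rw [← hM] at h1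
  have hDG : D * G = G * D - G * (U * V) * (1 - G) - z • (G * S) + z • (S * G) := by
    rw [← hc, hD]
    simp only [add_mul, mul_add, Matrix.smul_mul, Matrix.mul_smul]
    abel
  have h2 : V * D * G * Di * U = V * G * U - V * G * U * (V * (1 - G) * Di * U)
      - z • (V * G * Di * U * s) + z • (s * (V * G * Di * U)) := by
    have a1 : V * D * G * Di * U = V * (D * G) * Di * U := by simp only [Matrix.mul_assoc]
    have a2 : V * (G * D) * Di * U = V * G * U := by
      rw [Matrix.mul_assoc V, Matrix.mul_assoc G, hDi, Matrix.mul_one]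
    have a3 : V * (G * S) * Di * U = V * G * Di * U * s := by
      simp only [Matrix.mul_assoc]; rw [← hU, ← Matrix.mul_assoc S, hSD, Matrix.mul_assoc]
    have a4 : V * (S * G) * Di * U = s * (V * G * Di * U) := by
      simp only [← Matrix.mul_assoc]; rw [hV]
    rw [a1, hDG]
    simp only [Matrix.mul_add, Matrix.mul_sub, Matrix.add_mul, Matrix.sub_mul, Matrix.mul_smul,
      Matrix.smul_mul]
    rw [a2, a3, a4]
    simp only [Matrix.mul_assoc, Matrix.mul_sub, Matrix.sub_mul, Matrix.mul_one]
  have hN : V * G * Di * U = M - 1 + V * Di * U := by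
    rw [hM]; simp only [Matrix.mul_sub, Matrix.sub_mul, Matrix.mul_one]; abel
  have hK : V * Di * U * s = s * (V * Di * U) := by
    rw [Matrix.mul_assoc, ← hU, ← Matrix.mul_assoc, Matrix.mul_assoc V, ← hSD, ← Matrix.mul_assoc, hV]
    simp only [Matrix.mul_assoc]
  have hM1 : V * (1 - G) * Di * U = 1 - M := by rw [hM]; abel
  rw [Matrix.sub_mul, Matrix.sub_mul, h1, h2, hM1, hN, add_mul, hK, mul_add]
  simp only [sub_mul, mul_sub, one_mul, mul_one, smul_sub, smul_add, Matrix.smul_mul]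
  abel

lemma aux_perm (L S G G1 G2 Dx Dy Di : Matrix n n ℂ) (U : Matrix n m ℂ) (V : Matrix m n ℂ)
    (s M M' : Matrix m m ℂ) (x y : ℂ) (hDx : Dx = L + x • S) (hDy : Dy = L + y • S)
    (hsx : G1 * Dx - Dx * G = G1 * (U * V) * (1 - G))
    (hsy : G2 * Dy - Dy * G = G2 * (U * V) * (1 - G))
    (hDi : Dy * Di = 1) (hSD : S * Di = Di * S) (hV : V * S = s * V) (hU : S * U = U * s)
    (hM : M = 1 - V * (1 - G) * Di * U) (hM' : M' = 1 - V * (1 - G1) * Di * U) :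
    (x - y) • (M' * s) = -((V * G1 * U - V * G2 * U - (x - y) • s) * M) := by
  have h1 := aux_E1 G G2 Dy Di U V hsy hDi
  rw [← hM] at h1
  have hD : Dx = Dy + (x - y) • S := by rw [hDx, hDy, sub_smul]; abel
  have h := congrArg (fun X => V * X * Di * U) hsx
  have a1 : V * (G1 * Dx - Dx * G) * Di * U = V * G1 * U + (x - y) • (V * G1 * Di * U * s)
      - V * Dy * G * Di * U - (x - y) • (s * (V * G * Di * U)) := by
    have a2 : V * (G1 * Dy) * Di * U = V * G1 * U := by
      rw [Matrix.mul_assoc V, Matrix.mul_assoc G1, hDi, Matrix.mul_one]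
    have a3 : V * (G1 * S) * Di * U = V * G1 * Di * U * s := by
      simp only [Matrix.mul_assoc]; rw [← hU, ← Matrix.mul_assoc S, hSD, Matrix.mul_assoc]
    have a4 : V * (S * G) * Di * U = s * (V * G * Di * U) := by
      simp only [← Matrix.mul_assoc]; rw [hV]
    have a5 : V * (Dy * G) * Di * U = V * Dy * G * Di * U := by simp only [Matrix.mul_assoc]
    rw [hD]
    simp only [Matrix.mul_add, Matrix.mul_sub, Matrix.add_mul, Matrix.sub_mul, Matrix.mul_smul,
      Matrix.smul_mul]
    rw [a2, a3, a4, a5]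
    abel
  have a6 : V * (G1 * (U * V) * (1 - G)) * Di * U = V * G1 * U * (V * (1 - G) * Di * U) := by
    simp only [Matrix.mul_assoc]
  have hN : V * G * Di * U = M - 1 + V * Di * U := by
    rw [hM]; simp only [Matrix.mul_sub, Matrix.sub_mul, Matrix.mul_one]; abel
  have hN' : V * G1 * Di * U = M' - 1 + V * Di * U := by
    rw [hM']; simp only [Matrix.mul_sub, Matrix.sub_mul, Matrix.mul_one]; abel
  have hK : V * Di * U * s = s * (V * Di * U) := by
    rw [Matrix.mul_assoc, ← hU, ← Matrix.mul_assoc, Matrix.mul_assoc V, ← hSD, ← Matrix.mul_assoc, hV]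
    simp only [Matrix.mul_assoc]
  have hM1 : V * (1 - G) * Di * U = 1 - M := by rw [hM]; abel
  simp only [a1, a6, hM1, hN, hN', ← h1] at h
  simp only [add_mul, hK, mul_add, sub_mul, mul_sub, one_mul,
    mul_one, smul_sub, smul_add] at h
  simp only [sub_mul, Matrix.smul_mul]
  rw [← sub_eq_zero] at h ⊢
  rw [← h]
  abel

/-- The 2x2 algebra. -/
lemma aux_alg (P P1 P2 P12 s Mx My M' : Matrix (Fin 2) (Fin 2) ℂ) (x y f : ℂ) (hxy : x ≠ y)
    (hs : s = !![1, 0; 0, -1])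
    (hx : (P1 - P - x • s) * Mx = -(x • (Mx * s)))
    (hy : (P2 - P - y • s) * My = -(y • (My * s)))
    (hxy' : (P12 - P1 - y • s) * M' = -(y • (M' * s)))
    (hp : (x - y) • (M' * s) = -((P1 - P2 - (x - y) • s) * My))
    (hMx : Mx.det ≠ 0) (hMy : My.det ≠ 0) (hM' : M'.det ≠ 0) (hf : f = My.det / M'.det) :
    P12 - P - (x + y) • s = ((x + y) / (x - y) * f) • (P1 - P2 - (x - y) • s) := by
  have hss : s * s = 1 := by
    rw [hs]; ext i j; fin_cases i <;> fin_cases j <;> simp [Matrix.mul_apply, Fin.sum_univ_two]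
  have hst : s.trace = 0 := by rw [hs]; simp [Matrix.trace_fin_two]
  have hsd : s.det = -1 := by rw [hs]; simp [Matrix.det_fin_two]
  have hsub : x - y ≠ 0 := sub_ne_zero.mpr hxy
  have ux : Mx * Mx⁻¹ = 1 := Matrix.mul_nonsing_inv _ (isUnit_iff_ne_zero.mpr hMx)
  have uy : My * My⁻¹ = 1 := Matrix.mul_nonsing_inv _ (isUnit_iff_ne_zero.mpr hMy)
  have u' : M' * M'⁻¹ = 1 := Matrix.mul_nonsing_inv _ (isUnit_iff_ne_zero.mpr hM')
  have vx : Mx⁻¹ * Mx = 1 := Matrix.nonsing_inv_mul _ (isUnit_iff_ne_zero.mpr hMx)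
  have vy : My⁻¹ * My = 1 := Matrix.nonsing_inv_mul _ (isUnit_iff_ne_zero.mpr hMy)
  have v' : M'⁻¹ * M' = 1 := Matrix.nonsing_inv_mul _ (isUnit_iff_ne_zero.mpr hM')
  have conj : ∀ (Q M : Matrix (Fin 2) (Fin 2) ℂ) (z : ℂ), M * M⁻¹ = 1 →
      Q * M = -(z • (M * s)) → Q = -(z • (M * s * M⁻¹)) := by
    intro Q M z hu h
    have := congrArg (· * M⁻¹) h
    simpa only [mul_assoc, hu, mul_one, neg_mul, Matrix.smul_mul] using this
  have sq : ∀ (M : Matrix (Fin 2) (Fin 2) ℂ), M * M⁻¹ = 1 → M⁻¹ * M = 1 →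
      (M * s * M⁻¹) * (M * s * M⁻¹) = 1 := by
    intro M hu hv
    calc (M * s * M⁻¹) * (M * s * M⁻¹) = M * s * (M⁻¹ * M) * s * M⁻¹ := by noncomm_ring
      _ = M * (s * s) * M⁻¹ := by rw [hv]; noncomm_ring
      _ = 1 := by rw [hss, mul_one, hu]
  have tr0 : ∀ (M : Matrix (Fin 2) (Fin 2) ℂ), M⁻¹ * M = 1 →
      (M * s * M⁻¹).trace = 0 := by
    intro M hv
    rw [Matrix.trace_mul_comm, ← mul_assoc, hv, one_mul, hst]
  have cx := conj _ _ _ ux hx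
  have cy := conj _ _ _ uy hy
  set W := P1 - P2 - (x - y) • s with hW
  have hWab : W = y • (My * s * My⁻¹) - x • (Mx * s * Mx⁻¹) := by
    have : W = (P1 - P - x • s) - (P2 - P - y • s) := by rw [hW, sub_smul]; abel
    rw [this, cx, cy]; abel
  have hdet : W.det * My.det = -((x - y) ^ 2 * M'.det) := by
    have := congrArg Matrix.det hp
    simp only [Matrix.det_smul, Matrix.det_neg, Matrix.det_mul, hsd, Fintype.card_fin] at this
    linear_combination -this
  have hW2 : W * W = (-W.det) • (1 : Matrix (Fin 2) (Fin 2) ℂ) := by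
    have ht : W.trace = 0 := by
      rw [hWab, Matrix.trace_sub, Matrix.trace_smul, Matrix.trace_smul, tr0 _ vx, tr0 _ vy]; simp
    rw [Matrix.trace_fin_two] at ht
    have h11 : W 1 1 = - W 0 0 := by linear_combination ht
    ext i j
    fin_cases i <;> fin_cases j <;>
      simp [Matrix.mul_apply, Fin.sum_univ_two, Matrix.det_fin_two, h11] <;> ring
  have hWd : W.det ≠ 0 := by
    intro h0
    rw [h0, zero_mul] at hdet
    exact (mul_ne_zero (pow_ne_zero 2 hsub) hM') (neg_eq_zero.mp hdet.symm)
  have c' : (P12 - P1 - y • s) * W = -(y • (W * (My * s * My⁻¹))) := by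
    have e1 : (P12 - P1 - y • s) * ((x - y) • (M' * s)) = -(y • (((x - y) • (M' * s)) * s)) := by
      rw [Matrix.mul_smul, ← mul_assoc, hxy']
      simp only [neg_mul, Matrix.smul_mul, smul_neg]
      rw [smul_comm]
    rw [hp] at e1
    have e2 := congrArg (fun X => -(X * My⁻¹)) e1
    simp only [mul_neg, neg_mul, neg_neg, Matrix.smul_mul, smul_neg, mul_assoc, uy, mul_one] at e2
    rw [e2]; simp only [mul_assoc]
  have hYW : (P12 - P - (x + y) • s) * W = (x ^ 2 - y ^ 2) • (1 : Matrix (Fin 2) (Fin 2) ℂ) := by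
    have : P12 - P - (x + y) • s = (P12 - P1 - y • s) + (P1 - P - x • s) := by
      rw [add_smul]; abel
    rw [this, add_mul, c', cx, hWab]
    simp only [sub_mul, mul_sub, neg_mul, Matrix.smul_mul, Matrix.mul_smul, sq _ ux vx, sq _ uy vy,
      smul_sub, smul_smul, sub_smul, pow_two]
    rw [mul_comm y x]
    abel
  have hfin := congrArg (· * W) hYW
  simp only [mul_assoc, hW2, Matrix.smul_mul, Matrix.mul_smul, mul_one, one_mul] at hfin
  have hfW : f = -((x - y) ^ 2) / W.det := by
    rw [hf, div_eq_div_iff hM' hWd]; linear_combination hdet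
  have : P12 - P - (x + y) • s = (-W.det)⁻¹ • ((x ^ 2 - y ^ 2) • W) := by
    rw [← hfin, smul_smul, inv_mul_cancel₀ (neg_ne_zero.mpr hWd), one_smul]
  rw [this, smul_smul, hfW]
  congr 1
  field_simp
  ring

end MoutardAux

section MoutardBlocks
variable {N : ℕ}

/-- block version of `L`. -/
def blkL (l₁ l₂ : Fin N → ℂ) : Matrix (Fin N ⊕ Fin N) (Fin N ⊕ Fin N) ℂ :=
  Matrix.fromBlocks (Dg l₂) 0 0 (Dg l₁)

/-- block version of the sign matrix. -/
def blkS (N : ℕ) : Matrix (Fin N ⊕ Fin N) (Fin N ⊕ Fin N) ℂ :=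
  Matrix.fromBlocks 1 0 0 (-1)

/-- block version of `A`. -/
def blkA (A₁ A₂ : Mat N) : Matrix (Fin N ⊕ Fin N) (Fin N ⊕ Fin N) ℂ :=
  Matrix.fromBlocks 0 A₁ (-A₂) 0

/-- the inverse of `1 + blkA`. -/
noncomputable def blkG (A₁ A₂ : Mat N) : Matrix (Fin N ⊕ Fin N) (Fin N ⊕ Fin N) ℂ :=
  Matrix.fromBlocks (G₁D A₁ A₂) (-(G₁D A₁ A₂ * A₁)) (G₂D A₁ A₂ * A₂) (G₂D A₁ A₂)

/-- the inverse of `L + z S`. -/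
noncomputable def blkDi (l₁ l₂ : Fin N → ℂ) (z : ℂ) :
    Matrix (Fin N ⊕ Fin N) (Fin N ⊕ Fin N) ℂ :=
  Matrix.fromBlocks (Dg l₂ + z • 1)⁻¹ 0 0 (Dg l₁ - z • 1)⁻¹

/-- the two columns. -/
def blkU (ℓ₁ ℓ₂ : Fin N → ℂ) : Matrix (Fin N ⊕ Fin N) (Fin 2) ℂ :=
  Matrix.of (Sum.elim (fun a => ![ℓ₁ a, 0]) (fun a => ![0, ℓ₂ a]))

/-- the two rows. -/
def blkV (β₁ β₂ : Fin N → ℂ) : Matrix (Fin 2) (Fin N ⊕ Fin N) ℂ :=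
  Matrix.of ![Sum.elim β₁ 0, Sum.elim 0 β₂]

lemma fromBlocks_sub' {R : Type*} [AddGroup R] (a b c d a' b' c' d' : Matrix (Fin N) (Fin N) R) :
    Matrix.fromBlocks a b c d - Matrix.fromBlocks a' b' c' d' =
      Matrix.fromBlocks (a - a') (b - b') (c - c') (d - d') := by
  ext i j
  rcases i with i | i <;> rcases j with j | j <;> simp

lemma blk_UV (ℓ₁ ℓ₂ β₁ β₂ : Fin N → ℂ) : blkU ℓ₁ ℓ₂ * blkV β₁ β₂ =
    Matrix.fromBlocks (Matrix.vecMulVec ℓ₁ β₁) 0 0 (Matrix.vecMulVec ℓ₂ β₂) := by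
  ext i j
  rcases i with i | i <;> rcases j with j | j <;>
    simp [Matrix.mul_apply, Fin.sum_univ_two, blkU, blkV, Matrix.vecMulVec_apply]

lemma blk_AL (l₁ l₂ ℓ₁ ℓ₂ β₁ β₂ : Fin N → ℂ) (A₁ A₂ : Mat N)
    (h1 : (Dg l₂ - Matrix.vecMulVec ℓ₁ β₁) * A₁ = A₁ * Dg l₁)
    (h2 : (Dg l₁ - Matrix.vecMulVec ℓ₂ β₂) * A₂ = A₂ * Dg l₂) :
    blkA A₁ A₂ * blkL l₁ l₂ = blkL l₁ l₂ * blkA A₁ A₂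
      - (blkU ℓ₁ ℓ₂ * blkV β₁ β₂) * blkA A₁ A₂ := by
  rw [blk_UV, ← sub_mul]
  simp only [blkA, blkL, fromBlocks_sub', Matrix.fromBlocks_multiply]
  simp [h1, h2]

lemma blk_AS (A₁ A₂ : Mat N) : blkA A₁ A₂ * blkS N = -(blkS N * blkA A₁ A₂) := by
  simp [blkA, blkS, Matrix.fromBlocks_multiply, Matrix.fromBlocks_neg]

lemma blk_D (l₁ l₂ : Fin N → ℂ) (z : ℂ) : blkL l₁ l₂ + z • blkS N =
    Matrix.fromBlocks (Dg l₂ + z • 1) 0 0 (Dg l₁ - z • 1) := by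
  simp [blkL, blkS, Matrix.fromBlocks_smul, Matrix.fromBlocks_add, sub_eq_add_neg]

lemma blk_D' (l₁ l₂ : Fin N → ℂ) (z : ℂ) : blkL l₁ l₂ - z • blkS N =
    Matrix.fromBlocks (Dg l₂ - z • 1) 0 0 (Dg l₁ + z • 1) := by
  simp [blkL, blkS, Matrix.fromBlocks_smul, fromBlocks_sub']

lemma inv_l {M : Mat N} (h : IsUnit M) : M⁻¹ * M = 1 :=
  Matrix.nonsing_inv_mul _ ((Matrix.isUnit_iff_isUnit_det _).mp h)

lemma inv_r {M : Mat N} (h : IsUnit M) : M * M⁻¹ = 1 :=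
  Matrix.mul_nonsing_inv _ ((Matrix.isUnit_iff_isUnit_det _).mp h)

lemma blk_DDi (l₁ l₂ : Fin N → ℂ) (z : ℂ) (ha : IsUnit (Dg l₁ - z • (1 : Mat N)))
    (hb : IsUnit (Dg l₂ + z • (1 : Mat N))) :
    (blkL l₁ l₂ + z • blkS N) * blkDi l₁ l₂ z = 1 := by
  rw [blk_D, blkDi, Matrix.fromBlocks_multiply]
  simp [inv_r ha, inv_r hb]

lemma blk_SDi (l₁ l₂ : Fin N → ℂ) (z : ℂ) :
    blkS N * blkDi l₁ l₂ z = blkDi l₁ l₂ z * blkS N := by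
  simp [blkS, blkDi, Matrix.fromBlocks_multiply]

lemma blk_sh (l₁ l₂ : Fin N → ℂ) (z : ℂ) (A₁ A₂ : Mat N)
    (ha : IsUnit (Dg l₁ - z • (1 : Mat N)))
    (hb : IsUnit (Dg l₂ + z • (1 : Mat N))) :
    blkA (shA₁ l₁ z A₁) (shA₂ l₂ z A₂) * (blkL l₁ l₂ + z • blkS N)
      = blkA A₁ A₂ * (blkL l₁ l₂ - z • blkS N) := by
  rw [blk_D, blk_D']
  simp [blkA, shA₁, shA₂, Matrix.fromBlocks_multiply, Matrix.mul_assoc, inv_l ha, inv_l hb]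

lemma comm_inv' {X Y : Mat N} (hY : IsUnit Y) (h : X * Y = Y * X) : Y⁻¹ * X = X * Y⁻¹ := by
  calc Y⁻¹ * X = Y⁻¹ * (X * Y) * Y⁻¹ := by
        rw [mul_assoc, mul_assoc, inv_r hY, mul_one]
    _ = X * Y⁻¹ := by rw [h, ← mul_assoc, inv_l hY, one_mul]

lemma sh1_int (l₁ : Fin N → ℂ) (X A₁ : Mat N) (z : ℂ)
    (ha : IsUnit (Dg l₁ - z • (1 : Mat N))) (h1 : X * A₁ = A₁ * Dg l₁) :
    X * shA₁ l₁ z A₁ = shA₁ l₁ z A₁ * Dg l₁ := by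
  have hc := comm_inv' (X := Dg l₁) ha (by simp [mul_sub, sub_mul])
  rw [shA₁, mul_assoc _ _ (Dg l₁), hc, ← mul_assoc, ← mul_assoc, h1]
  simp [mul_add, add_mul, mul_assoc]

lemma sh2_int (l₂ : Fin N → ℂ) (X A₂ : Mat N) (z : ℂ)
    (ha : IsUnit (Dg l₂ + z • (1 : Mat N))) (h1 : X * A₂ = A₂ * Dg l₂) :
    X * shA₂ l₂ z A₂ = shA₂ l₂ z A₂ * Dg l₂ := by
  have hc := comm_inv' (X := Dg l₂) ha (by simp [mul_add, add_mul])
  rw [shA₂, mul_assoc _ _ (Dg l₂), hc, ← mul_assoc, ← mul_assoc, h1]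
  simp [mul_sub, sub_mul, mul_assoc]

lemma blk_G (A₁ A₂ : Mat N) (h : IsUnit (1 + A₁ * A₂)) : blkG A₁ A₂ * (1 + blkA A₁ A₂) = 1 := by
  have h' : IsUnit (1 + A₂ * A₁) := by
    rw [Matrix.isUnit_iff_isUnit_det] at h ⊢
    rwa [Matrix.det_one_add_mul_comm]
  have e1 : G₁D A₁ A₂ + G₁D A₁ A₂ * A₁ * A₂ = 1 := by
    rw [G₁D, mul_assoc]; rw [← mul_one_add]; exact inv_l h
  have e2 : G₂D A₁ A₂ * A₂ * A₁ + G₂D A₁ A₂ = 1 := by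
    rw [G₂D, mul_assoc, add_comm]; rw [← mul_one_add]; exact inv_l h'
  rw [blkG, blkA, ← Matrix.fromBlocks_one, Matrix.fromBlocks_add, Matrix.fromBlocks_multiply]
  simp [e1, e2]

lemma blk_tau (A₁ A₂ : Mat N) : (1 + blkA A₁ A₂).det = tauD A₁ A₂ := by
  rw [blkA, ← Matrix.fromBlocks_one, Matrix.fromBlocks_add, tauD]
  simp [Matrix.det_fromBlocks_one₂₂]

lemma blk_VS (β₁ β₂ : Fin N → ℂ) :
    blkV β₁ β₂ * blkS N = (!![1, 0; 0, -1] : Matrix (Fin 2) (Fin 2) ℂ) * blkV β₁ β₂ := by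
  ext i j
  rcases j with j | j <;> fin_cases i <;>
    simp [Matrix.mul_apply, Fin.sum_univ_two, blkV, blkS, Matrix.one_apply]

lemma blk_SU (ℓ₁ ℓ₂ : Fin N → ℂ) :
    blkS N * blkU ℓ₁ ℓ₂ = blkU ℓ₁ ℓ₂ * (!![1, 0; 0, -1] : Matrix (Fin 2) (Fin 2) ℂ) := by
  ext i j
  rcases i with i | i <;> fin_cases j <;>
    simp [Matrix.mul_apply, Fin.sum_univ_two, blkU, blkS, Matrix.one_apply]

lemma blk_P_gen (ℓ₁ ℓ₂ β₁ β₂ : Fin N → ℂ) (a b c d : Mat N) :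
    blkV β₁ β₂ * Matrix.fromBlocks a b c d * blkU ℓ₁ ℓ₂ =
      !![β₁ ⬝ᵥ (a *ᵥ ℓ₁), β₁ ⬝ᵥ (b *ᵥ ℓ₂); β₂ ⬝ᵥ (c *ᵥ ℓ₁), β₂ ⬝ᵥ (d *ᵥ ℓ₂)] := by
  have key : ∀ (X : Mat N) (v w : Fin N → ℂ),
      v ⬝ᵥ (X *ᵥ w) = ∑ x, (∑ y, v y * X y x) * w x := by
    intro X v w
    rw [Matrix.dotProduct_mulVec]; rfl
  ext i j
  rw [Matrix.mul_apply]
  simp only [Matrix.mul_apply, Fintype.sum_sum_type, key]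
  fin_cases i <;> fin_cases j <;> simp [blkU, blkV]

lemma blk_P (ℓ₁ ℓ₂ β₁ β₂ : Fin N → ℂ) (A₁ A₂ : Mat N) :
    blkV β₁ β₂ * blkG A₁ A₂ * blkU ℓ₁ ℓ₂ =
      !![1 - pD β₁ ℓ₁ A₁ A₂, -qD β₁ ℓ₂ A₁ A₂; rD β₂ ℓ₁ A₁ A₂, 1 - sD β₂ ℓ₂ A₁ A₂] := by
  rw [blkG, blk_P_gen]
  simp [pD, qD, rD, sD, Matrix.neg_mulVec, dotProduct_neg]

end MoutardBlocks

/-- Moutard-type two-shift relations for `p`, `q`, `r`, with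
`f = τ^ξτ^η/(ττ^{ξη})`. -/
theorem soliton_moutard_relations {N : ℕ} (hN : 1 ≤ N)
    (l₁ l₂ ℓ₁ ℓ₂ β₁ β₂ : Fin N → ℂ) (A₁ A₂ : Mat N)
    (h1 : (Dg l₂ - Matrix.vecMulVec ℓ₁ β₁) * A₁ = A₁ * Dg l₁)
    (h2 : (Dg l₁ - Matrix.vecMulVec ℓ₂ β₂) * A₂ = A₂ * Dg l₂)
    (hG : IsUnit (1 + A₁ * A₂))
    (ξ η : ℂ) (hξη : ξ ≠ η)
    (hξ1 : IsUnit (Dg l₁ - ξ • (1 : Mat N))) (hξ2 : IsUnit (Dg l₁ + ξ • (1 : Mat N)))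
    (hξ3 : IsUnit (Dg l₂ - ξ • (1 : Mat N))) (hξ4 : IsUnit (Dg l₂ + ξ • (1 : Mat N)))
    (hη1 : IsUnit (Dg l₁ - η • (1 : Mat N))) (hη2 : IsUnit (Dg l₁ + η • (1 : Mat N)))
    (hη3 : IsUnit (Dg l₂ - η • (1 : Mat N))) (hη4 : IsUnit (Dg l₂ + η • (1 : Mat N)))
    (hK1ξ : 1 - β₁z l₂ β₁ ξ ⬝ᵥ ℓ₁ ≠ 0) (hK2ξ : 1 - β₂z l₁ β₂ ξ ⬝ᵥ ℓ₂ ≠ 0)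
    (hK1η : 1 - β₁z l₂ β₁ η ⬝ᵥ ℓ₁ ≠ 0) (hK2η : 1 - β₂z l₁ β₂ η ⬝ᵥ ℓ₂ ≠ 0)
    (hGξ : IsUnit (1 + shA₁ l₁ ξ A₁ * shA₂ l₂ ξ A₂))
    (hGη : IsUnit (1 + shA₁ l₁ η A₁ * shA₂ l₂ η A₂))
    (hGξη : IsUnit (1 + shA₁ l₁ η (shA₁ l₁ ξ A₁) * shA₂ l₂ η (shA₂ l₂ ξ A₂)))
    (f : ℂ)
    (hf : f = tauD (shA₁ l₁ ξ A₁) (shA₂ l₂ ξ A₂) * tauD (shA₁ l₁ η A₁) (shA₂ l₂ η A₂)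
        / (tauD A₁ A₂ * tauD (shA₁ l₁ η (shA₁ l₁ ξ A₁)) (shA₂ l₂ η (shA₂ l₂ ξ A₂)))) :
    pD β₁ ℓ₁ (shA₁ l₁ η (shA₁ l₁ ξ A₁)) (shA₂ l₂ η (shA₂ l₂ ξ A₂)) - pD β₁ ℓ₁ A₁ A₂ + ξ + η
      = ((ξ + η) / (ξ - η)) * f *
          (pD β₁ ℓ₁ (shA₁ l₁ ξ A₁) (shA₂ l₂ ξ A₂)
            - pD β₁ ℓ₁ (shA₁ l₁ η A₁) (shA₂ l₂ η A₂) + ξ - η)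
    ∧ qD β₁ ℓ₂ (shA₁ l₁ η (shA₁ l₁ ξ A₁)) (shA₂ l₂ η (shA₂ l₂ ξ A₂)) - qD β₁ ℓ₂ A₁ A₂
      = ((ξ + η) / (ξ - η)) * f *
          (qD β₁ ℓ₂ (shA₁ l₁ ξ A₁) (shA₂ l₂ ξ A₂)
            - qD β₁ ℓ₂ (shA₁ l₁ η A₁) (shA₂ l₂ η A₂))
    ∧ rD β₂ ℓ₁ (shA₁ l₁ η (shA₁ l₁ ξ A₁)) (shA₂ l₂ η (shA₂ l₂ ξ A₂)) - rD β₂ ℓ₁ A₁ A₂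
      = ((ξ + η) / (ξ - η)) * f *
          (rD β₂ ℓ₁ (shA₁ l₁ ξ A₁) (shA₂ l₂ ξ A₂)
            - rD β₂ ℓ₁ (shA₁ l₁ η A₁) (shA₂ l₂ η A₂)) := by
  have hAL := blk_AL l₁ l₂ ℓ₁ ℓ₂ β₁ β₂ A₁ A₂ h1 h2
  have hALx := blk_AL l₁ l₂ ℓ₁ ℓ₂ β₁ β₂ _ _ (sh1_int l₁ _ A₁ ξ hξ1 h1) (sh2_int l₂ _ A₂ ξ hξ4 h2)
  have hDx := blk_DDi l₁ l₂ ξ hξ1 hξ4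
  have hDy := blk_DDi l₁ l₂ η hη1 hη4
  have shx := blk_sh l₁ l₂ ξ A₁ A₂ hξ1 hξ4
  have shy := blk_sh l₁ l₂ η A₁ A₂ hη1 hη4
  have shxy := blk_sh l₁ l₂ η (shA₁ l₁ ξ A₁) (shA₂ l₂ ξ A₂) hη1 hη4
  have g := blk_G _ _ hG
  have gx := blk_G _ _ hGξ
  have gy := blk_G _ _ hGη
  have gxy := blk_G _ _ hGξη
  have tne : ∀ X Y : Mat N, IsUnit (1 + X * Y) → tauD X Y ≠ 0 := fun X Y h =>
    ((Matrix.isUnit_iff_isUnit_det _).mp h).ne_zero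
  have t0 := tne _ _ hG
  have tx := tne _ _ hGξ
  have ty := tne _ _ hGη
  have txy := tne _ _ hGξη
  have sx := aux_step _ _ _ _ _ _ _ _ ξ rfl hAL (blk_AS A₁ A₂) shx (mul_eq_one_comm.mp g) gx
  have sy := aux_step _ _ _ _ _ _ _ _ η rfl hAL (blk_AS A₁ A₂) shy (mul_eq_one_comm.mp g) gy
  have sxy := aux_step _ _ _ _ _ _ _ _ η rfl hALx (blk_AS _ _) shxy (mul_eq_one_comm.mp gx) gxy
  have s0 := aux_step _ _ _ _ _ _ _ (blkL l₁ l₂) 0 (by simp) hAL (blk_AS A₁ A₂) (by simp)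
    (mul_eq_one_comm.mp g) g
  have s0x := aux_step _ _ _ _ _ _ _ (blkL l₁ l₂) 0 (by simp) hALx (blk_AS _ _) (by simp)
    (mul_eq_one_comm.mp gx) gx
  have dx := aux_det _ _ _ _ _ _ _ _ _ ξ rfl hAL (blk_AS A₁ A₂) shx g hDx
  have dy := aux_det _ _ _ _ _ _ _ _ _ η rfl hAL (blk_AS A₁ A₂) shy g hDy
  have dxy := aux_det _ _ _ _ _ _ _ _ _ η rfl hALx (blk_AS _ _) shxy gx hDy
  rw [blk_tau, blk_tau] at dx dy dxy
  have mx := aux_shift _ _ _ _ _ _ _ _ _ _ ξ rfl sx s0 hDx (blk_SDi l₁ l₂ ξ)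
    (blk_VS β₁ β₂) (blk_SU ℓ₁ ℓ₂) rfl
  have my := aux_shift _ _ _ _ _ _ _ _ _ _ η rfl sy s0 hDy (blk_SDi l₁ l₂ η)
    (blk_VS β₁ β₂) (blk_SU ℓ₁ ℓ₂) rfl
  have mxy := aux_shift _ _ _ _ _ _ _ _ _ _ η rfl sxy s0x hDy (blk_SDi l₁ l₂ η)
    (blk_VS β₁ β₂) (blk_SU ℓ₁ ℓ₂) rfl
  have pm := aux_perm _ _ _ _ _ _ _ _ _ _ _ _ _ ξ η rfl rfl sx sy hDy (blk_SDi l₁ l₂ η)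
    (blk_VS β₁ β₂) (blk_SU ℓ₁ ℓ₂) rfl rfl
  have nx := right_ne_zero_of_mul (dx ▸ tx)
  have ny := right_ne_zero_of_mul (dy ▸ ty)
  have nxy := right_ne_zero_of_mul (dxy ▸ txy)
  have main := aux_alg _ _ _ _ _ _ _ _ ξ η f hξη rfl mx my mxy pm nx ny nxy (by
    rw [hf, dxy, dy]
    field_simp)
  simp only [blk_P] at main
  have m00 := congrFun (congrFun main 0) 0
  have m01 := congrFun (congrFun main 0) 1
  have m10 := congrFun (congrFun main 1) 0
  simp at m00 m01 m10
  refine ⟨?_, ?_, ?_⟩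
  · linear_combination -m00
  · linear_combination -m01
  · linear_combination m10
end

section
/- In the soliton matrix setup, let ξ, η ∈ ℂ with ξ ≠ η be such that L₁ ± ξ, L₂ ± ξ, L₁ ± η, L₂ ± η are all invertible, 1 − β₁ζℓ₁ ≠ 0 and 1 − β₂ζℓ₂ ≠ 0 for ζ ∈ {ξ, η}, and such that 1 + A₁^{ξη}A₂^{ξη} is invertible, and set f = τ^ξ·τ^η/(τ·τ^{ξη}). Then the quadrilinear norm identity holds: (p^{ξη} − p + ξ + η)² − (q^{ξη} − q)·(r^{ξη} − r) = (ξ + η)²·f, where X^{ξη} denotes the value of X computed from the doubly shifted matrices A₁^{ξη}, A₂^{ξη}. -/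
open Matrix

namespace SolAux

section generic
variable {n : Type*} [Fintype n] [DecidableEq n]

lemma core (J A T G : Matrix n n ℂ) (hJ : T * A = J * A + A * J) (hG : (1 + A) * G = 1)
    (hG' : G * (1 + A) = 1) (ξ η : ℂ) :
    (J + ξ • 1) * (J + η • 1) + A * ((J - ξ • 1) * (J - η • 1)) - (2 : ℂ) • (T * G * A * J)
      = ((1 - A) * J + ξ • (1 + A)) * G * ((1 - A) * J + η • (1 + A)) := by
  have hAG : A * G = 1 - G := by
    rw [add_mul, one_mul] at hG
    exact eq_sub_of_add_eq' hG
  have hGA : G * A = 1 - G := by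
    rw [mul_add, mul_one] at hG'
    exact eq_sub_of_add_eq' hG'
  have e1 : (1 - A) * J = J * (1 + A) - T * A := by rw [hJ]; noncomm_ring
  have e2 : ((1 - A) * J + ξ • (1 + A)) * G = J + ξ • 1 - T * (A * G) := by
    rw [e1, add_mul, sub_mul, smul_mul_assoc, mul_assoc J, hG, mul_one, mul_assoc T]
    abel
  have e3 : T * (A * G) * (1 + A) = T * A := by
    rw [mul_assoc, mul_assoc A, hG', mul_one]
  have e4 : T * (A * G) * ((1 - A) * J + η • (1 + A))
      = (2 : ℂ) • (T * G * A * J) - T * A * J + η • (T * A) := by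
    have : (1 - A : Matrix n n ℂ) = (2 : ℂ) • 1 - (1 + A) := by module
    rw [mul_add, mul_smul_comm, e3, this, sub_mul, mul_sub, ← mul_assoc _ (1 + A), e3,
      mul_assoc T G A, hGA, hAG]
    simp
  rw [e2, sub_mul (J + ξ • 1), e4, hJ]
  simp only [add_mul, mul_add, sub_mul, mul_sub, smul_mul_assoc, mul_smul_comm, one_mul, mul_one,
    mul_assoc, smul_add, smul_sub]
  module

end generic

variable {N : ℕ}

def blk (A₁ A₂ : Mat N) : Matrix (Fin N ⊕ Fin N) (Fin N ⊕ Fin N) ℂ := fromBlocks 0 A₁ (-A₂) 0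

def Jm (l₁ l₂ : Fin N → ℂ) : Matrix (Fin N ⊕ Fin N) (Fin N ⊕ Fin N) ℂ :=
  fromBlocks (Dg l₂) 0 0 (-Dg l₁)

def Sg (N : ℕ) : Matrix (Fin N ⊕ Fin N) (Fin N ⊕ Fin N) ℂ := fromBlocks 1 0 0 (-1)

def Bm (β₁ β₂ : Fin N → ℂ) : Matrix (Unit ⊕ Unit) (Fin N ⊕ Fin N) ℂ :=
  fromBlocks (replicateRow Unit β₁) 0 0 (replicateRow Unit β₂)

def Em (ℓ₁ ℓ₂ : Fin N → ℂ) : Matrix (Fin N ⊕ Fin N) (Unit ⊕ Unit) ℂ :=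
  fromBlocks (replicateCol Unit ℓ₁) 0 0 (-replicateCol Unit ℓ₂)

lemma det_blk (A₁ A₂ : Mat N) : (1 + blk A₁ A₂).det = tauD A₁ A₂ := by
  rw [blk, tauD, ← fromBlocks_one, fromBlocks_add]
  simp [det_fromBlocks_one₂₂]

lemma isUnit_swap (A₁ A₂ : Mat N) (h : IsUnit (1 + A₁ * A₂)) : IsUnit (1 + A₂ * A₁) := by
  rw [Matrix.isUnit_iff_isUnit_det] at *
  rwa [det_one_add_mul_comm]

lemma GA_comm (A₁ A₂ : Mat N) (h : IsUnit (1 + A₁ * A₂)) :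
    A₂ * G₁D A₁ A₂ = G₂D A₁ A₂ * A₂ := by
  have h' := isUnit_swap _ _ h
  rw [Matrix.isUnit_iff_isUnit_det] at h h'
  have e : (1 + A₂ * A₁) * A₂ = A₂ * (1 + A₁ * A₂) := by noncomm_ring
  calc A₂ * G₁D A₁ A₂ = G₂D A₁ A₂ * ((1 + A₂ * A₁) * A₂) * G₁D A₁ A₂ := by
        rw [← mul_assoc (G₂D A₁ A₂), G₂D, nonsing_inv_mul _ h', one_mul]
    _ = _ := by
        rw [e, mul_assoc, mul_assoc A₂, G₁D, mul_nonsing_inv _ h, mul_one]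

lemma GA_comm' (A₁ A₂ : Mat N) (h : IsUnit (1 + A₁ * A₂)) :
    A₁ * G₂D A₁ A₂ = G₁D A₁ A₂ * A₁ := GA_comm A₂ A₁ (isUnit_swap _ _ h)

lemma inv_blk (A₁ A₂ : Mat N) (h : IsUnit (1 + A₁ * A₂)) :
    (1 + blk A₁ A₂) * fromBlocks (G₁D A₁ A₂) (-(G₁D A₁ A₂ * A₁)) (G₂D A₁ A₂ * A₂) (G₂D A₁ A₂)
      = 1 := by
  have c1 := GA_comm A₁ A₂ h
  have c2 := GA_comm' A₁ A₂ h
  have h' := isUnit_swap _ _ h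
  rw [Matrix.isUnit_iff_isUnit_det] at h h'
  have g1 : G₁D A₁ A₂ + A₁ * (A₂ * G₁D A₁ A₂) = 1 := by
    rw [← mul_nonsing_inv _ h, G₁D]; noncomm_ring
  have g2 : G₂D A₁ A₂ + A₂ * (A₁ * G₂D A₁ A₂) = 1 := by
    rw [← mul_nonsing_inv _ h', G₂D]; noncomm_ring
  rw [blk, ← fromBlocks_one, fromBlocks_add, fromBlocks_multiply, ← c1, ← c2]
  congr 1
  · simpa using g1
  · simp
  · simp
  · simpa [add_comm] using g2

lemma inv_blk' (A₁ A₂ : Mat N) (h : IsUnit (1 + A₁ * A₂)) : (1 + blk A₁ A₂)⁻¹ =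
    fromBlocks (G₁D A₁ A₂) (-(G₁D A₁ A₂ * A₁)) (G₂D A₁ A₂ * A₂) (G₂D A₁ A₂) :=
  inv_eq_right_inv (inv_blk A₁ A₂ h)

lemma smul_one_blk (ζ : ℂ) : (ζ • 1 : Matrix (Fin N ⊕ Fin N) (Fin N ⊕ Fin N) ℂ)
    = fromBlocks (ζ • 1) 0 0 (ζ • 1) := by
  rw [← fromBlocks_one, fromBlocks_smul]; simp

lemma Jm_add (l₁ l₂ : Fin N → ℂ) (ζ : ℂ) : Jm l₁ l₂ + ζ • 1 =
    fromBlocks (Dg l₂ + ζ • 1) 0 0 (-(Dg l₁ - ζ • 1)) := by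
  rw [smul_one_blk, Jm, fromBlocks_add]; congr 1 <;> simp; abel

lemma Jm_sub (l₁ l₂ : Fin N → ℂ) (ζ : ℂ) : Jm l₁ l₂ - ζ • 1 =
    fromBlocks (Dg l₂ - ζ • 1) 0 0 (-(Dg l₁ + ζ • 1)) := by
  rw [smul_one_blk, Jm, sub_eq_add_neg, fromBlocks_neg, fromBlocks_add]; congr 1 <;> simp <;> abel

lemma shift (l₁ l₂ : Fin N → ℂ) (ζ : ℂ) (A₁ A₂ : Mat N)
    (h1 : IsUnit (Dg l₁ - ζ • (1 : Mat N))) (h2 : IsUnit (Dg l₂ + ζ • (1 : Mat N))) :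
    blk (shA₁ l₁ ζ A₁) (shA₂ l₂ ζ A₂) * (Jm l₁ l₂ + ζ • 1)
      = blk A₁ A₂ * (Jm l₁ l₂ - ζ • 1) := by
  rw [Matrix.isUnit_iff_isUnit_det] at h1 h2
  rw [Jm_add, Jm_sub, blk, blk, fromBlocks_multiply, fromBlocks_multiply]
  congr 1
  · simp
  · simp only [zero_mul, zero_add, mul_neg, mul_zero, shA₁]
    rw [mul_assoc _ _ (Dg l₁ - ζ • 1), nonsing_inv_mul _ h1, mul_one]
  · simp only [zero_mul, add_zero, neg_mul, mul_zero, shA₂]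
    rw [mul_assoc _ _ (Dg l₂ + ζ • 1), nonsing_inv_mul _ h2, mul_one]
  · simp

lemma det_J (l₁ l₂ : Fin N → ℂ) (ζ : ℂ)
    (h1 : IsUnit (Dg l₁ - ζ • (1 : Mat N))) (h2 : IsUnit (Dg l₂ + ζ • (1 : Mat N))) :
    IsUnit (Jm l₁ l₂ + ζ • 1).det := by
  rw [Jm_add, det_fromBlocks_zero₂₁]
  have h1' := h1.neg
  rw [Matrix.isUnit_iff_isUnit_det] at h1' h2
  exact h2.mul h1'

lemma Sg_sq : Sg N * Sg N = 1 := by simp [Sg, fromBlocks_multiply]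

lemma Sg_blk (A₁ A₂ : Mat N) : Sg N * blk A₁ A₂ = - (blk A₁ A₂ * Sg N) := by
  simp [Sg, blk, fromBlocks_multiply, fromBlocks_neg]

lemma Sg_J (l₁ l₂ : Fin N → ℂ) : Sg N * Jm l₁ l₂ = Jm l₁ l₂ * Sg N := by
  simp [Sg, Jm, fromBlocks_multiply]

lemma det_Q (l₁ l₂ : Fin N → ℂ) (ζ : ℂ) (A₁ A₂ : Mat N)
    (h1 : IsUnit (Dg l₁ - ζ • (1 : Mat N))) (h2 : IsUnit (Dg l₂ + ζ • (1 : Mat N))) :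
    ((1 - blk A₁ A₂) * Jm l₁ l₂ + ζ • (1 + blk A₁ A₂)).det
      = tauD (shA₁ l₁ ζ A₁) (shA₂ l₂ ζ A₂) * (Jm l₁ l₂ + ζ • 1).det := by
  have e : (1 + blk (shA₁ l₁ ζ A₁) (shA₂ l₂ ζ A₂)) * (Jm l₁ l₂ + ζ • 1) * Sg N
      = Sg N * ((1 - blk A₁ A₂) * Jm l₁ l₂ + ζ • (1 + blk A₁ A₂)) := by
    rw [add_mul, shift l₁ l₂ ζ A₁ A₂ h1 h2]
    have a := Sg_blk A₁ A₂
    have b := Sg_J l₁ l₂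
    simp only [add_mul, mul_add, sub_mul, mul_sub, smul_mul_assoc, mul_smul_comm, one_mul, mul_one,
      ← mul_assoc, smul_add, a, b, neg_mul]
    simp only [mul_assoc, b]
    module
  have hS : (Sg N).det ≠ 0 := by
    intro h0
    have := congrArg det (Sg_sq (N := N))
    rw [det_mul, h0, det_one] at this
    simp at this
  rw [← det_blk]
  have := congrArg det e
  rw [det_mul, det_mul, det_mul, mul_comm (Sg N).det] at this
  exact (mul_right_cancel₀ hS this).symm

lemma hJ_blk (l₁ l₂ ℓ₁ ℓ₂ β₁ β₂ : Fin N → ℂ) (A₁ A₂ : Mat N)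
    (h1 : (Dg l₂ - Matrix.vecMulVec ℓ₁ β₁) * A₁ = A₁ * Dg l₁)
    (h2 : (Dg l₁ - Matrix.vecMulVec ℓ₂ β₂) * A₂ = A₂ * Dg l₂) :
    (Em ℓ₁ ℓ₂ * Bm β₁ β₂) * blk A₁ A₂ = Jm l₁ l₂ * blk A₁ A₂ + blk A₁ A₂ * Jm l₁ l₂ := by
  have r1 : replicateCol Unit ℓ₁ * replicateRow Unit β₁ = vecMulVec ℓ₁ β₁ :=
    (vecMulVec_eq Unit ℓ₁ β₁).symm
  have r2 : replicateCol Unit ℓ₂ * replicateRow Unit β₂ = vecMulVec ℓ₂ β₂ :=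
    (vecMulVec_eq Unit ℓ₂ β₂).symm
  rw [Em, Bm, Jm, blk]
  simp only [fromBlocks_multiply, fromBlocks_add]
  rw [sub_mul] at h1 h2
  congr 1
  · simp
  · simp only [r1, Matrix.mul_zero, Matrix.zero_mul, add_zero, zero_add, Matrix.mul_neg, ← h1]; abel
  · simp only [Matrix.neg_mul, r2, Matrix.mul_zero, Matrix.zero_mul, add_zero, zero_add,
      Matrix.mul_neg, ← h2, neg_neg]; abel
  · simp

lemma trace_rel (l₁ l₂ ℓ₁ ℓ₂ β₁ β₂ : Fin N → ℂ) (A₁ A₂ : Mat N)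
    (h1 : (Dg l₂ - Matrix.vecMulVec ℓ₁ β₁) * A₁ = A₁ * Dg l₁)
    (h2 : (Dg l₁ - Matrix.vecMulVec ℓ₂ β₂) * A₂ = A₂ * Dg l₂) (h : IsUnit (1 + A₁ * A₂)) :
    β₁ ⬝ᵥ (G₁D A₁ A₂ *ᵥ ℓ₁) + β₂ ⬝ᵥ (G₂D A₁ A₂ *ᵥ ℓ₂)
      = trace (vecMulVec ℓ₁ β₁) + trace (vecMulVec ℓ₂ β₂) := by
  have t (G : Mat N) (b l : Fin N → ℂ) : b ⬝ᵥ (G *ᵥ l) = trace (vecMulVec l b * G) := by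
    rw [vecMulVec_mul, trace_vecMulVec, dotProduct_mulVec, dotProduct_comm]
  have c1 := GA_comm A₁ A₂ h
  have c2 := GA_comm' A₁ A₂ h
  have h' := isUnit_swap _ _ h
  rw [Matrix.isUnit_iff_isUnit_det] at h h'
  have g1 : G₁D A₁ A₂ = 1 - A₁ * (A₂ * G₁D A₁ A₂) := by
    rw [eq_sub_iff_add_eq, ← mul_nonsing_inv _ h, G₁D]; noncomm_ring
  have g2 : G₂D A₁ A₂ = 1 - A₂ * (A₁ * G₂D A₁ A₂) := by
    rw [eq_sub_iff_add_eq, ← mul_nonsing_inv _ h', G₂D]; noncomm_ring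
  have v1 : vecMulVec ℓ₁ β₁ * A₁ = Dg l₂ * A₁ - A₁ * Dg l₁ := by rw [← h1]; noncomm_ring
  have v2 : vecMulVec ℓ₂ β₂ * A₂ = Dg l₁ * A₂ - A₂ * Dg l₂ := by rw [← h2]; noncomm_ring
  rw [t, t, g1, g2, mul_sub, mul_sub, mul_one, mul_one, ← mul_assoc _ A₁, ← mul_assoc _ A₂ (A₁ * _),
    v1, v2]
  simp only [sub_mul, trace_sub]
  have x1 : trace (A₂ * Dg l₂ * (A₁ * G₂D A₁ A₂)) = trace (Dg l₂ * A₁ * (A₂ * G₁D A₁ A₂)) := by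
    rw [c1, mul_assoc, trace_mul_comm]; simp only [mul_assoc]
  have x2 : trace (A₁ * Dg l₁ * (A₂ * G₁D A₁ A₂)) = trace (Dg l₁ * A₂ * (A₁ * G₂D A₁ A₂)) := by
    rw [c2, mul_assoc, trace_mul_comm]; simp only [mul_assoc]
  rw [x1, x2]; ring

lemma sh_rel1 (l₁ l₂ ℓ₁ β₁ : Fin N → ℂ) (A₁ : Mat N) (ζ : ℂ)
    (hu : IsUnit (Dg l₁ - ζ • (1 : Mat N)))
    (h1 : (Dg l₂ - Matrix.vecMulVec ℓ₁ β₁) * A₁ = A₁ * Dg l₁) :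
    (Dg l₂ - Matrix.vecMulVec ℓ₁ β₁) * shA₁ l₁ ζ A₁ = shA₁ l₁ ζ A₁ * Dg l₁ := by
  have c : Commute (Dg l₁) ((Dg l₁ + ζ • 1) * (Dg l₁ - ζ • 1)⁻¹) := by
    apply Commute.mul_right
    · exact (Commute.refl _).add_right ((Commute.one_right _).smul_right ζ)
    · rw [← hu.unit_spec, ← coe_units_inv]
      apply Commute.units_inv_right
      rw [hu.unit_spec]
      exact (Commute.refl _).sub_right ((Commute.one_right _).smul_right ζ)
  rw [shA₁, mul_assoc A₁, ← mul_assoc, h1, mul_assoc, c.eq, mul_assoc A₁]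

lemma sh_rel2 (l₁ l₂ ℓ₂ β₂ : Fin N → ℂ) (A₂ : Mat N) (ζ : ℂ)
    (hu : IsUnit (Dg l₂ + ζ • (1 : Mat N)))
    (h2 : (Dg l₁ - Matrix.vecMulVec ℓ₂ β₂) * A₂ = A₂ * Dg l₂) :
    (Dg l₁ - Matrix.vecMulVec ℓ₂ β₂) * shA₂ l₂ ζ A₂ = shA₂ l₂ ζ A₂ * Dg l₂ := by
  have e : shA₂ l₂ ζ A₂ = shA₁ l₂ (-ζ) A₂ := by
    simp only [shA₂, shA₁, neg_smul, sub_neg_eq_add, ← sub_eq_add_neg]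
  rw [e]
  apply sh_rel1 l₂ l₁ ℓ₂ β₂ A₂ (-ζ) _ h2
  simpa using hu

def cst (a : ℂ) : Matrix Unit Unit ℂ := Matrix.of fun _ _ => a

lemma det_cst (a b c d : ℂ) :
    (fromBlocks (cst a) (cst b) (cst c) (cst d)).det = a * d - b * c := by
  let e : Fin 2 ≃ Unit ⊕ Unit :=
    { toFun := ![Sum.inl (), Sum.inr ()]
      invFun := Sum.elim (fun _ => 0) (fun _ => 1)
      left_inv := by intro i; fin_cases i <;> rfl
      right_inv := by rintro (_ | _) <;> rfl }
  rw [← det_submatrix_equiv_self e, det_fin_two]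
  simp [e, cst]

lemma BGE (ℓ₁ ℓ₂ β₁ β₂ : Fin N → ℂ) (A₁ A₂ : Mat N) (h : IsUnit (1 + A₁ * A₂)) :
    Bm β₁ β₂ * (1 + blk A₁ A₂)⁻¹ * Em ℓ₁ ℓ₂ =
      fromBlocks (cst (1 - pD β₁ ℓ₁ A₁ A₂)) (cst (qD β₁ ℓ₂ A₁ A₂))
        (cst (rD β₂ ℓ₁ A₁ A₂)) (cst (- (β₂ ⬝ᵥ (G₂D A₁ A₂ *ᵥ ℓ₂)))) := by
  have t (G : Mat N) (b l : Fin N → ℂ) : replicateRow Unit b * G * replicateCol Unit l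
      = cst (b ⬝ᵥ (G *ᵥ l)) := by
    rw [Matrix.mul_assoc, ← replicateCol_mulVec]
    ext i j
    simp [cst, Matrix.mul_apply, dotProduct]
  have cn (a : ℂ) : - cst a = cst (-a) := by ext; simp [cst]
  rw [inv_blk' _ _ h, Bm, Em]
  simp only [fromBlocks_multiply, Matrix.mul_zero, Matrix.zero_mul, add_zero, zero_add,
    Matrix.mul_neg, Matrix.neg_mul, neg_neg, neg_zero, t, pD, qD, rD, mulVec_mulVec, sub_sub_cancel, cn]

end SolAux

open SolAux

/-- the quadrilinear norm identity
`(p^{ξη} − p + ξ + η)² − (q^{ξη} − q)(r^{ξη} − r) = (ξ + η)²·f`,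
with `f = τ^ξτ^η/(ττ^{ξη})`. -/
theorem soliton_quadrilinear_identity {N : ℕ} (hN : 1 ≤ N)
    (l₁ l₂ ℓ₁ ℓ₂ β₁ β₂ : Fin N → ℂ) (A₁ A₂ : Mat N)
    (h1 : (Dg l₂ - Matrix.vecMulVec ℓ₁ β₁) * A₁ = A₁ * Dg l₁)
    (h2 : (Dg l₁ - Matrix.vecMulVec ℓ₂ β₂) * A₂ = A₂ * Dg l₂)
    (hG : IsUnit (1 + A₁ * A₂))
    (ξ η : ℂ) (hξη : ξ ≠ η)
    (hξ1 : IsUnit (Dg l₁ - ξ • (1 : Mat N))) (hξ2 : IsUnit (Dg l₁ + ξ • (1 : Mat N)))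
    (hξ3 : IsUnit (Dg l₂ - ξ • (1 : Mat N))) (hξ4 : IsUnit (Dg l₂ + ξ • (1 : Mat N)))
    (hη1 : IsUnit (Dg l₁ - η • (1 : Mat N))) (hη2 : IsUnit (Dg l₁ + η • (1 : Mat N)))
    (hη3 : IsUnit (Dg l₂ - η • (1 : Mat N))) (hη4 : IsUnit (Dg l₂ + η • (1 : Mat N)))
    (hK1ξ : 1 - β₁z l₂ β₁ ξ ⬝ᵥ ℓ₁ ≠ 0) (hK2ξ : 1 - β₂z l₁ β₂ ξ ⬝ᵥ ℓ₂ ≠ 0)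
    (hK1η : 1 - β₁z l₂ β₁ η ⬝ᵥ ℓ₁ ≠ 0) (hK2η : 1 - β₂z l₁ β₂ η ⬝ᵥ ℓ₂ ≠ 0)
    (hGξη : IsUnit (1 + shA₁ l₁ η (shA₁ l₁ ξ A₁) * shA₂ l₂ η (shA₂ l₂ ξ A₂)))
    (f : ℂ)
    (hf : f = tauD (shA₁ l₁ ξ A₁) (shA₂ l₂ ξ A₂) * tauD (shA₁ l₁ η A₁) (shA₂ l₂ η A₂)
        / (tauD A₁ A₂ * tauD (shA₁ l₁ η (shA₁ l₁ ξ A₁)) (shA₂ l₂ η (shA₂ l₂ ξ A₂)))) :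
    (pD β₁ ℓ₁ (shA₁ l₁ η (shA₁ l₁ ξ A₁)) (shA₂ l₂ η (shA₂ l₂ ξ A₂))
        - pD β₁ ℓ₁ A₁ A₂ + ξ + η) ^ 2
      - (qD β₁ ℓ₂ (shA₁ l₁ η (shA₁ l₁ ξ A₁)) (shA₂ l₂ η (shA₂ l₂ ξ A₂)) - qD β₁ ℓ₂ A₁ A₂) *
        (rD β₂ ℓ₁ (shA₁ l₁ η (shA₁ l₁ ξ A₁)) (shA₂ l₂ η (shA₂ l₂ ξ A₂)) - rD β₂ ℓ₁ A₁ A₂)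
      = (ξ + η) ^ 2 * f := by
  set C₁ := shA₁ l₁ η (shA₁ l₁ ξ A₁) with hC₁
  set C₂ := shA₂ l₂ η (shA₂ l₂ ξ A₂) with hC₂
  have k1 : (Dg l₂ - Matrix.vecMulVec ℓ₁ β₁) * C₁ = C₁ * Dg l₁ :=
    sh_rel1 _ _ _ _ _ _ hη1 (sh_rel1 _ _ _ _ _ _ hξ1 h1)
  have k2 : (Dg l₁ - Matrix.vecMulVec ℓ₂ β₂) * C₂ = C₂ * Dg l₂ :=
    sh_rel2 _ _ _ _ _ _ hη4 (sh_rel2 _ _ _ _ _ _ hξ4 h2)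
  have tr := (trace_rel l₁ l₂ ℓ₁ ℓ₂ β₁ β₂ A₁ A₂ h1 h2 hG).trans
    (trace_rel l₁ l₂ ℓ₁ ℓ₂ β₁ β₂ C₁ C₂ k1 k2 hGξη).symm
  have bg := BGE ℓ₁ ℓ₂ β₁ β₂ A₁ A₂ hG
  have bg' := BGE ℓ₁ ℓ₂ β₁ β₂ C₁ C₂ hGξη
  have hτ : IsUnit (1 + blk A₁ A₂).det := by
    rw [det_blk]; exact (Matrix.isUnit_iff_isUnit_det _).1 hG
  have hτ' : IsUnit (1 + blk C₁ C₂).det := by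
    rw [det_blk]; exact (Matrix.isUnit_iff_isUnit_det _).1 hGξη
  have djξ := det_J l₁ l₂ ξ hξ1 hξ4
  have djη := det_J l₁ l₂ η hη1 hη4
  have dqξ := det_Q l₁ l₂ ξ A₁ A₂ hξ1 hξ4
  have dqη := det_Q l₁ l₂ η A₁ A₂ hη1 hη4
  have hJ := hJ_blk l₁ l₂ ℓ₁ ℓ₂ β₁ β₂ A₁ A₂ h1 h2
  have s1 := shift l₁ l₂ ξ A₁ A₂ hξ1 hξ4
  have s2 := shift l₁ l₂ η (shA₁ l₁ ξ A₁) (shA₂ l₂ ξ A₂) hη1 hη4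
  rw [← hC₁, ← hC₂] at s2
  rw [← det_blk A₁ A₂, ← det_blk C₁ C₂] at hf
  have hcore := core (Jm l₁ l₂) (blk A₁ A₂) (Em ℓ₁ ℓ₂ * Bm β₁ β₂) (1 + blk A₁ A₂)⁻¹ hJ
    (mul_nonsing_inv _ hτ) (nonsing_inv_mul _ hτ) ξ η
  generalize blk (shA₁ l₁ ξ A₁) (shA₂ l₂ ξ A₂) = Aξ at *
  generalize blk C₁ C₂ = A' at *
  generalize blk A₁ A₂ = A at *
  generalize Jm l₁ l₂ = J at *
  generalize Em ℓ₁ ℓ₂ = E at *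
  generalize Bm β₁ β₂ = B at *
  have cJ : (J - η • 1) * (J + ξ • 1) = (J + ξ • 1) * (J - η • 1) := by
    simp only [add_mul, mul_add, sub_mul, mul_sub, smul_mul_assoc, mul_smul_comm, one_mul, mul_one]
    module
  have cJ' : (J + η • 1) * (J + ξ • 1) = (J + ξ • 1) * (J + η • 1) := by
    simp only [add_mul, mul_add, smul_mul_assoc, mul_smul_comm, one_mul, mul_one]
    module
  have s3 : A' * ((J + ξ • 1) * (J + η • 1)) = A * ((J - ξ • 1) * (J - η • 1)) := by
    rw [← cJ', ← mul_assoc, s2, mul_assoc, cJ, ← mul_assoc, s1, mul_assoc]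
  have hV : IsUnit ((J + ξ • 1) * (J + η • 1)).det := by
    rw [det_mul]; exact djξ.mul djη
  have hVd : ((J + ξ • 1) * (J + η • 1)).det = (J + ξ • 1).det * (J + η • 1).det := det_mul _ _
  have s4 : (A' - A) * ((J + ξ • 1) * (J + η • 1)) = (-2 * (ξ + η)) • (A * J) := by
    rw [sub_mul, s3]
    simp only [add_mul, mul_add, sub_mul, mul_sub, smul_mul_assoc, mul_smul_comm, one_mul, mul_one,
      smul_add, smul_sub]
    module
  generalize (J + ξ • 1) * (J + η • 1) = V at *
  have s5 : A' - A = (-2 * (ξ + η)) • (A * J * V⁻¹) := by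
    rw [← smul_mul_assoc, ← s4, mul_assoc, mul_nonsing_inv _ hV, mul_one]
  have hGG : (1 + A)⁻¹ - (1 + A')⁻¹
      = (-2 * (ξ + η)) • ((1 + A)⁻¹ * A * J * V⁻¹ * (1 + A')⁻¹) := by
    have : (1 + A)⁻¹ - (1 + A')⁻¹ = (1 + A)⁻¹ * ((1 + A') - (1 + A)) * (1 + A')⁻¹ := by
      rw [mul_sub, sub_mul, nonsing_inv_mul _ hτ, mul_assoc, mul_nonsing_inv _ hτ', mul_one, one_mul]
    rw [this, add_sub_add_left_eq_sub, s5]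
    simp only [mul_smul_comm, smul_mul_assoc, mul_assoc]
  have hW : (ξ + η) • (1 : Matrix (Unit ⊕ Unit) (Unit ⊕ Unit) ℂ)
        + (B * (1 + A)⁻¹ * E - B * (1 + A')⁻¹ * E)
      = (ξ + η) • (1 + B * ((-2 : ℂ) • ((1 + A)⁻¹ * A * J * V⁻¹ * (1 + A')⁻¹)) * E) := by
    rw [← Matrix.sub_mul, ← Matrix.mul_sub, hGG]
    simp only [Matrix.mul_smul, Matrix.smul_mul, smul_add, smul_smul, Matrix.mul_assoc]
    congr 2
    ring
  have hK : (1 + E * (B * ((-2 : ℂ) • ((1 + A)⁻¹ * A * J * V⁻¹ * (1 + A')⁻¹)))).det = f := by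
    have e : (1 + E * (B * ((-2 : ℂ) • ((1 + A)⁻¹ * A * J * V⁻¹ * (1 + A')⁻¹)))) * (1 + A') * V
        = V + A * ((J - ξ • 1) * (J - η • 1)) - (2 : ℂ) • (E * B * (1 + A)⁻¹ * A * J) := by
      have c : (1 + A)⁻¹ * A * J * V⁻¹ * (1 + A')⁻¹ * (1 + A') * V = (1 + A)⁻¹ * A * J := by
        rw [mul_assoc _ (1 + A')⁻¹, nonsing_inv_mul _ hτ', mul_one, mul_assoc _ V⁻¹,
          nonsing_inv_mul _ hV, mul_one]
      rw [← Matrix.mul_assoc E B, mul_smul_comm, add_mul, add_mul, one_mul, smul_mul_assoc,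
        smul_mul_assoc, mul_assoc (E * B), mul_assoc (E * B), c, add_mul, one_mul, s3]
      simp only [mul_assoc, neg_smul, sub_eq_add_neg]
    have d := congrArg det (e.trans hcore)
    rw [det_mul, det_mul, det_mul, det_mul, dqξ, dqη, hVd, det_nonsing_inv,
      Ring.inverse_eq_inv'] at d
    have n1 := djξ.ne_zero
    have n2 := djη.ne_zero
    have n3 := hτ.ne_zero
    have n4 := hτ'.ne_zero
    rw [hf, eq_div_iff (mul_ne_zero n3 n4)]
    apply mul_right_cancel₀ (mul_ne_zero n1 n2)
    calc _ = (1 + A).det * (_ * (1 + A').det * ((J + ξ • 1).det * (J + η • 1).det)) := by ring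
      _ = _ := by rw [d]; field_simp
  have hdet := congrArg det hW
  have hL : (ξ + η) • (1 : Matrix (Unit ⊕ Unit) (Unit ⊕ Unit) ℂ)
        + (B * (1 + A)⁻¹ * E - B * (1 + A')⁻¹ * E)
      = fromBlocks (cst (pD β₁ ℓ₁ C₁ C₂ - pD β₁ ℓ₁ A₁ A₂ + ξ + η))
          (cst (qD β₁ ℓ₂ A₁ A₂ - qD β₁ ℓ₂ C₁ C₂)) (cst (rD β₂ ℓ₁ A₁ A₂ - rD β₂ ℓ₁ C₁ C₂))
          (cst (pD β₁ ℓ₁ C₁ C₂ - pD β₁ ℓ₁ A₁ A₂ + ξ + η)) := by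
    rw [bg, bg']
    ext (i | i) (j | j)
    · simp [cst]; ring
    · simp [cst]
    · simp [cst]
    · simp only [pD]
      simp [cst]
      linear_combination -tr
  rw [det_smul, det_one_add_mul_comm, hK, hL, det_cst] at hdet
  simp only [Fintype.card_sum, Fintype.card_unit] at hdet
  linear_combination hdet
end

section
/- (Proposition 3.1, lattice realization.) Fix real numbers μ, ν with μ² ≠ ν² such that L_k ∉ {iμ, −iμ, iν, −iν} for all k, and assume 1 − β(conj(L) − ζ)⁻¹ℓ ≠ 0 and 1 − conj(β)(L + ζ)⁻¹conj(ℓ) ≠ 0 for ζ ∈ {iμ, iν}. For (m,n) ∈ ℤ² set A_{m,n} = A·H_μ^m·H_ν^n, assume 1 + A_{m,n}·conj(A_{m,n}) is invertible with inverse G_{m,n}, and define the scalars p_{m,n} = 1 − β·G_{m,n}·ℓ and q_{m,n} = β·G_{m,n}·A_{m,n}·conj(ℓ), and the vector φ_{m,n} = (Re q_{m,n}, Im q_{m,n}, Im p_{m,n} + mμ + nν)ᵀ ∈ ℝ³. Then for every (m,n) with φ_{m+1,n+1} ≠ φ_{m,n} one has φ_{m+1,n} − φ_{m,n+1} = (μ²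 − ν²) • (φ_{m+1,n+1} − φ_{m,n})/‖φ_{m+1,n+1} − φ_{m,n}‖². -/
open Matrix

namespace SolitonAux

/-- The defining linear system of the dressed vectors. -/
def Sol {N : ℕ} (A : Matrix (Fin N) (Fin N) ℂ) (v x y : Fin N → ℂ) : Prop :=
  x - A *ᵥ star y = v ∧ y + A *ᵥ star x = 0

lemma star_mulVec_map {N : ℕ} (A : Matrix (Fin N) (Fin N) ℂ) (v : Fin N → ℂ) :
    star (A *ᵥ v) = A.map (starRingEnd ℂ) *ᵥ star v := by
  ext k
  simp [Matrix.mulVec, dotProduct]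

lemma uniq {N : ℕ} (A : Matrix (Fin N) (Fin N) ℂ)
    (hA : IsUnit (1 + A * A.map (starRingEnd ℂ))) (u v : Fin N → ℂ)
    (h1 : u - A *ᵥ star v = 0) (h2 : v + A *ᵥ star u = 0) : u = 0 ∧ v = 0 := by
  have hv : v = - (A *ᵥ star u) := eq_neg_of_add_eq_zero_left h2
  have hu : (1 + A * A.map (starRingEnd ℂ)) *ᵥ u = 0 := by
    rw [hv, star_neg, star_mulVec_map, star_star, mulVec_neg, mulVec_mulVec, sub_neg_eq_add] at h1
    rw [add_mulVec, one_mulVec, h1]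
  have hu0 : u = 0 := by
    have := congrArg (fun w => (1 + A * A.map (starRingEnd ℂ))⁻¹ *ᵥ w) hu
    simpa [mulVec_mulVec, Matrix.nonsing_inv_mul _ ((Matrix.isUnit_iff_isUnit_det _).1 hA)] using this
  refine ⟨hu0, ?_⟩
  rw [hv, hu0]; simp

lemma exists_sol {N : ℕ} (A : Matrix (Fin N) (Fin N) ℂ)
    (hA : IsUnit (1 + A * A.map (starRingEnd ℂ))) (v : Fin N → ℂ) :
    ∃ x y, Sol A v x y ∧ (1 + A * A.map (starRingEnd ℂ))⁻¹ *ᵥ v = x ∧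
      (1 + A * A.map (starRingEnd ℂ))⁻¹ *ᵥ (A *ᵥ star v) = -y := by
  have hd := (Matrix.isUnit_iff_isUnit_det _).1 hA
  set M := 1 + A * A.map (starRingEnd ℂ) with hM
  set x := M⁻¹ *ᵥ v with hx
  have hMx : M *ᵥ x = v := by
    rw [hx, mulVec_mulVec, Matrix.mul_nonsing_inv _ hd, one_mulVec]
  have hxe : x + A *ᵥ (A.map (starRingEnd ℂ) *ᵥ x) = v := by
    rw [← hMx, hM, add_mulVec, one_mulVec, mulVec_mulVec]
  refine ⟨x, -(A *ᵥ star x), ⟨?_, by simp⟩, rfl, ?_⟩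
  · rw [star_neg, star_mulVec_map, star_star, mulVec_neg, sub_neg_eq_add, hxe]
  · have : A *ᵥ star v = M *ᵥ (A *ᵥ star x) := by
      have e : star (A.map (starRingEnd ℂ) *ᵥ x) = A *ᵥ star x := by
        ext i
        simp [Matrix.mulVec, dotProduct]
      conv_lhs => rw [← hxe, star_add, star_mulVec_map A (A.map (starRingEnd ℂ) *ᵥ x), e]
      rw [hM, add_mulVec, one_mulVec, mulVec_add, ← mulVec_mulVec]
    rw [this, mulVec_mulVec, Matrix.nonsing_inv_mul _ hd, one_mulVec, neg_neg]

lemma step {N : ℕ} (l v β : Fin N → ℂ) (A A₁ : Matrix (Fin N) (Fin N) ℂ) (μ : ℝ)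
    (h0 : (diagonal (fun k => starRingEnd ℂ (l k)) - vecMulVec v β) * A = A * diagonal l)
    (h1 : (diagonal (fun k => starRingEnd ℂ (l k)) - vecMulVec v β) * A₁ = A₁ * diagonal l)
    (h01 : A₁ * diagonal (fun k => l k - Complex.I * μ)
      = A * diagonal (fun k => l k + Complex.I * μ))
    (hA : IsUnit (1 + A₁ * A₁.map (starRingEnd ℂ)))
    (x y x₁ y₁ : Fin N → ℂ) (hs : Sol A v x y) (hs₁ : Sol A₁ v x₁ y₁) (a b : ℂ)
    (ha : a = Complex.I * μ + β ⬝ᵥ x - β ⬝ᵥ x₁) (hb : b = β ⬝ᵥ y - β ⬝ᵥ y₁) (k : Fin N) :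
    (starRingEnd ℂ (l k) + Complex.I * μ) * x k
        = starRingEnd ℂ (l k) * x₁ k + x₁ k * a - y₁ k * starRingEnd ℂ b ∧
    (starRingEnd ℂ (l k) + Complex.I * μ) * y k
        = starRingEnd ℂ (l k) * y₁ k + x₁ k * b + y₁ k * starRingEnd ℂ a := by
  have gen : ∀ (B : Matrix (Fin N) (Fin N) ℂ),
      (diagonal (fun k => starRingEnd ℂ (l k)) - vecMulVec v β) * B = B * diagonal l →
      ∀ w : Fin N → ℂ, B *ᵥ (fun k => l k * w k) =
        fun k => starRingEnd ℂ (l k) * (B *ᵥ w) k - v k * (β ⬝ᵥ (B *ᵥ w)) := by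
    intro B hB w
    have e : (fun k => l k * w k) = diagonal l *ᵥ w := by
      ext k; simp [mulVec_diagonal]
    rw [e, mulVec_mulVec, ← hB, ← mulVec_mulVec, sub_mulVec]
    ext k
    simp [-mulVec_mulVec, mulVec_diagonal, vecMulVec_mulVec, mul_comm]
  have sh : ∀ w : Fin N → ℂ, A₁ *ᵥ (fun k => (l k - Complex.I * μ) * w k) =
      A *ᵥ (fun k => l k * w k) + (Complex.I * μ) • (A *ᵥ w) := by
    intro w
    have e : (fun k => (l k - Complex.I * μ) * w k)
        = diagonal (fun k => l k - Complex.I * μ) *ᵥ w := by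
      ext k; simp [mulVec_diagonal]
    rw [e, mulVec_mulVec, h01, ← mulVec_mulVec, ← mulVec_smul, ← mulVec_add]
    congr 1
    ext k; simp [mulVec_diagonal]; ring
  obtain ⟨s1, s2⟩ := hs
  obtain ⟨t1, t2⟩ := hs₁
  have s1' : A *ᵥ star y = x - v := by rw [← s1]; abel
  have s2' : A *ᵥ star x = -y := eq_neg_of_add_eq_zero_right s2
  have t1' : A₁ *ᵥ star y₁ = x₁ - v := by rw [← t1]; abel
  have t2' : A₁ *ᵥ star x₁ = -y₁ := eq_neg_of_add_eq_zero_right t2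
  set u : Fin N → ℂ := fun k => (starRingEnd ℂ (l k) + Complex.I * μ) * x k
        - (starRingEnd ℂ (l k) * x₁ k + x₁ k * a - y₁ k * starRingEnd ℂ b) with hu
  set w : Fin N → ℂ := fun k => (starRingEnd ℂ (l k) + Complex.I * μ) * y k
        - (starRingEnd ℂ (l k) * y₁ k + x₁ k * b + y₁ k * starRingEnd ℂ a) with hw
  have su : star u = (fun k => (l k - Complex.I * μ) * star x k) - (fun k => l k * star x₁ k)
      - (starRingEnd ℂ a) • star x₁ + b • star y₁ := by
    ext k; simp [hu]; ring
  have sw : star w = (fun k => (l k - Complex.I * μ) * star y k) - (fun k => l k * star y₁ k)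
      - (starRingEnd ℂ b) • star x₁ - a • star y₁ := by
    ext k; simp [hw]; ring
  have key := uniq A₁ hA u w (by
    rw [sw, mulVec_sub, mulVec_sub, mulVec_sub, sh, gen A h0, gen A₁ h1, mulVec_smul, mulVec_smul,
      s1', t1', t2']
    ext k
    simp only [hu, Pi.sub_apply, Pi.add_apply, Pi.smul_apply, Pi.neg_apply, smul_eq_mul,
      Pi.zero_apply, dotProduct_sub]
    rw [ha]; ring) (by
    rw [su, mulVec_add, mulVec_sub, mulVec_sub, sh, gen A h0, gen A₁ h1, mulVec_smul, mulVec_smul,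
      s2', t1', t2']
    ext k
    simp only [hw, Pi.sub_apply, Pi.add_apply, Pi.smul_apply, Pi.neg_apply, smul_eq_mul,
      Pi.zero_apply, dotProduct_neg]
    rw [hb]; ring)
  exact ⟨sub_eq_zero.1 (congrFun key.1 k), sub_eq_zero.1 (congrFun key.2 k)⟩

lemma quat_zero (x y Q R : ℂ) (h1 : x * Q - y * starRingEnd ℂ R = 0)
    (h2 : x * R + y * starRingEnd ℂ Q = 0) (h : ¬ (x = 0 ∧ y = 0)) : Q = 0 ∧ R = 0 := by
  have hx : x * ((Complex.normSq Q + Complex.normSq R : ℝ) : ℂ) = 0 := by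
    push_cast
    rw [← Complex.mul_conj, ← Complex.mul_conj]
    linear_combination starRingEnd ℂ Q * h1 + starRingEnd ℂ R * h2
  have hy : y * ((Complex.normSq Q + Complex.normSq R : ℝ) : ℂ) = 0 := by
    push_cast
    rw [← Complex.mul_conj, ← Complex.mul_conj]
    linear_combination Q * h2 - R * h1
  have h0 : Complex.normSq Q + Complex.normSq R = 0 := by
    by_contra hne
    have hne' : ((Complex.normSq Q + Complex.normSq R : ℝ) : ℂ) ≠ 0 := by exact_mod_cast hne
    exact h ⟨(mul_eq_zero.1 hx).resolve_right hne', (mul_eq_zero.1 hy).resolve_right hne'⟩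
  have hQ := Complex.normSq_nonneg Q
  have hR := Complex.normSq_nonneg R
  exact ⟨Complex.normSq_eq_zero.1 (by linarith), Complex.normSq_eq_zero.1 (by linarith)⟩

lemma norm_rel (μ : ℝ) (a b : ℂ)
    (h1 : (μ : ℂ) ^ 2 + a ^ 2 - b * starRingEnd ℂ b = 0)
    (h2 : b * (a + starRingEnd ℂ a) = 0) :
    a.re = 0 ∧ a.im ^ 2 + b.re ^ 2 + b.im ^ 2 = μ ^ 2 := by
  have e1 := congrArg Complex.re h1
  have e2 := congrArg Complex.im h1
  have e3 := congrArg Complex.re h2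
  have e4 := congrArg Complex.im h2
  simp [pow_two] at e1 e2 e3 e4
  have hr : a.re = 0 := by
    by_contra hne
    have hi : a.im = 0 := by
      have : a.re * a.im = 0 := by linarith
      exact (mul_eq_zero.1 this).resolve_left hne
    have hbr : b.re = 0 := by rcases e3 with h | h; exacts [h, absurd (by linarith) hne]
    have hbi : b.im = 0 := by rcases e4 with h | h; exacts [h, absurd (by linarith) hne]
    rw [hi, hbr, hbi] at e1
    have : 0 < a.re ^ 2 := by positivity
    nlinarith [sq_nonneg μ]
  refine ⟨hr, ?_⟩
  rw [hr] at e1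
  linarith

/-- A nonzero source gives a nonzero dressed pair at some index. -/
lemma sol_ne {N : ℕ} {A : Matrix (Fin N) (Fin N) ℂ} {v x y : Fin N → ℂ} (h : Sol A v x y)
    (hv : v ≠ 0) : ∃ k, ¬ (x k = 0 ∧ y k = 0) := by
  by_contra! hc
  apply hv
  have hx : x = 0 := funext fun k => (hc k).1
  have hy : y = 0 := funext fun k => (hc k).2
  rw [← h.1, hx, hy]; simp

lemma sol_zero {N : ℕ} {A : Matrix (Fin N) (Fin N) ℂ} {x y : Fin N → ℂ} (h : Sol A 0 x y)
    (hA : IsUnit (1 + A * A.map (starRingEnd ℂ))) : x = 0 ∧ y = 0 :=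
  uniq A hA x y h.1 h.2

lemma norm_step {N : ℕ} (l v β : Fin N → ℂ) (A A₁ : Matrix (Fin N) (Fin N) ℂ) (μ : ℝ)
    (h0 : (diagonal (fun k => starRingEnd ℂ (l k)) - vecMulVec v β) * A = A * diagonal l)
    (h1 : (diagonal (fun k => starRingEnd ℂ (l k)) - vecMulVec v β) * A₁ = A₁ * diagonal l)
    (h01 : A₁ * diagonal (fun k => l k - Complex.I * μ)
      = A * diagonal (fun k => l k + Complex.I * μ))
    (hA : IsUnit (1 + A * A.map (starRingEnd ℂ)))
    (hA₁ : IsUnit (1 + A₁ * A₁.map (starRingEnd ℂ)))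
    (x y x₁ y₁ : Fin N → ℂ) (hs : Sol A v x y) (hs₁ : Sol A₁ v x₁ y₁) (a b : ℂ)
    (ha : a = Complex.I * μ + β ⬝ᵥ x - β ⬝ᵥ x₁) (hb : b = β ⬝ᵥ y - β ⬝ᵥ y₁) :
    a.re = 0 ∧ a.im ^ 2 + b.re ^ 2 + b.im ^ 2 = μ ^ 2 := by
  by_cases hv : v = 0
  · subst hv
    obtain ⟨rfl, rfl⟩ := sol_zero hs hA
    obtain ⟨rfl, rfl⟩ := sol_zero hs₁ hA₁
    simp at ha hb
    subst ha hb
    simp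
  · obtain ⟨k, hk⟩ := sol_ne hs hv
    have F := step l v β A A₁ μ h0 h1 h01 hA₁ x y x₁ y₁ hs hs₁ a b ha hb k
    have B := step l v β A₁ A (-μ) h1 h0 (by
      simpa [sub_eq_add_neg] using h01.symm) hA x₁ y₁ x y hs₁ hs (-a) (-b)
      (by rw [ha]; push_cast; ring) (by rw [hb]; ring) k
    obtain ⟨f1, f2⟩ := F
    obtain ⟨g1, g2⟩ := B
    simp only [map_neg, Complex.ofReal_neg] at g1 g2
    have hI := Complex.I_sq
    set c := starRingEnd ℂ (l k)
    have q := quat_zero (x k) (y k) ((μ : ℂ) ^ 2 + a ^ 2 - b * starRingEnd ℂ b)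
      (b * (a + starRingEnd ℂ a))
      (by
        simp only [map_mul, map_add, Complex.conj_conj]
        linear_combination (c - Complex.I * μ) * f1 + c * g1 + a * g1 - starRingEnd ℂ b * g2
          + (μ : ℂ) ^ 2 * x k * hI)
      (by
        simp only [map_mul, map_add, map_sub, map_pow, Complex.conj_conj, Complex.conj_ofReal]
        linear_combination (c - Complex.I * μ) * f2 + c * g2 + b * g1 + starRingEnd ℂ a * g2
          + (μ : ℂ) ^ 2 * y k * hI) hk
    exact norm_rel μ a b q.1 q.2

lemma compat {N : ℕ} (l v β : Fin N → ℂ) (A A₁ A₂ A₃ : Matrix (Fin N) (Fin N) ℂ) (μ ν : ℝ)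
    (h0 : (diagonal (fun k => starRingEnd ℂ (l k)) - vecMulVec v β) * A = A * diagonal l)
    (h1 : (diagonal (fun k => starRingEnd ℂ (l k)) - vecMulVec v β) * A₁ = A₁ * diagonal l)
    (h2 : (diagonal (fun k => starRingEnd ℂ (l k)) - vecMulVec v β) * A₂ = A₂ * diagonal l)
    (h3 : (diagonal (fun k => starRingEnd ℂ (l k)) - vecMulVec v β) * A₃ = A₃ * diagonal l)
    (h01 : A₁ * diagonal (fun k => l k - Complex.I * μ)
      = A * diagonal (fun k => l k + Complex.I * μ))
    (h02 : A₂ * diagonal (fun k => l k - Complex.I * ν)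
      = A * diagonal (fun k => l k + Complex.I * ν))
    (h13 : A₃ * diagonal (fun k => l k - Complex.I * ν)
      = A₁ * diagonal (fun k => l k + Complex.I * ν))
    (h23 : A₃ * diagonal (fun k => l k - Complex.I * μ)
      = A₂ * diagonal (fun k => l k + Complex.I * μ))
    (hA : IsUnit (1 + A * A.map (starRingEnd ℂ)))
    (hA₁ : IsUnit (1 + A₁ * A₁.map (starRingEnd ℂ)))
    (hA₂ : IsUnit (1 + A₂ * A₂.map (starRingEnd ℂ)))
    (hA₃ : IsUnit (1 + A₃ * A₃.map (starRingEnd ℂ)))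
    (x y x₁ y₁ x₂ y₂ x₃ y₃ : Fin N → ℂ) (hs : Sol A v x y) (hs₁ : Sol A₁ v x₁ y₁)
    (hs₂ : Sol A₂ v x₂ y₂) (hs₃ : Sol A₃ v x₃ y₃) (a b c d e f g h : ℂ)
    (ha : a = Complex.I * μ + β ⬝ᵥ x - β ⬝ᵥ x₁) (hb : b = β ⬝ᵥ y - β ⬝ᵥ y₁)
    (hc : c = Complex.I * ν + β ⬝ᵥ x₁ - β ⬝ᵥ x₃) (hd : d = β ⬝ᵥ y₁ - β ⬝ᵥ y₃)
    (he : e = Complex.I * ν + β ⬝ᵥ x - β ⬝ᵥ x₂) (hf : f = β ⬝ᵥ y - β ⬝ᵥ y₂)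
    (hg : g = Complex.I * μ + β ⬝ᵥ x₂ - β ⬝ᵥ x₃) (hh : h = β ⬝ᵥ y₂ - β ⬝ᵥ y₃) :
    c * a - d * starRingEnd ℂ b = g * e - h * starRingEnd ℂ f ∧
    c * b + d * starRingEnd ℂ a = g * f + h * starRingEnd ℂ e := by
  by_cases hv : v = 0
  · subst hv
    obtain ⟨rfl, rfl⟩ := sol_zero hs hA
    obtain ⟨rfl, rfl⟩ := sol_zero hs₁ hA₁
    obtain ⟨rfl, rfl⟩ := sol_zero hs₂ hA₂
    obtain ⟨rfl, rfl⟩ := sol_zero hs₃ hA₃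
    simp at ha hb hc hd he hf hg hh
    subst ha hb hc hd he hf hg hh
    simp
    ring
  · obtain ⟨k, hk⟩ := sol_ne hs₃ hv
    obtain ⟨p1, p2⟩ := step l v β A A₁ μ h0 h1 h01 hA₁ x y x₁ y₁ hs hs₁ a b ha hb k
    obtain ⟨q1, q2⟩ := step l v β A₁ A₃ ν h1 h3 h13 hA₃ x₁ y₁ x₃ y₃ hs₁ hs₃ c d hc hd k
    obtain ⟨r1, r2⟩ := step l v β A A₂ ν h0 h2 h02 hA₂ x y x₂ y₂ hs hs₂ e f he hf k
    obtain ⟨s1, s2⟩ := step l v β A₂ A₃ μ h2 h3 h23 hA₃ x₂ y₂ x₃ y₃ hs₂ hs₃ g h hg hh k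
    have t1 : a + c = e + g := by rw [ha, hc, he, hg]; ring
    have t2 : b + d = f + h := by rw [hb, hd, hf, hh]; ring
    have t1' : starRingEnd ℂ a + starRingEnd ℂ c = starRingEnd ℂ e + starRingEnd ℂ g := by
      rw [← map_add, t1, map_add]
    have t2' : starRingEnd ℂ b + starRingEnd ℂ d = starRingEnd ℂ f + starRingEnd ℂ h := by
      rw [← map_add, t2, map_add]
    set w := starRingEnd ℂ (l k)
    have q := quat_zero (x₃ k) (y₃ k)
      (c * a - d * starRingEnd ℂ b - (g * e - h * starRingEnd ℂ f))
      (c * b + d * starRingEnd ℂ a - (g * f + h * starRingEnd ℂ e))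
      (by
        simp only [map_mul, map_add, map_sub, Complex.conj_conj]
        linear_combination -(w + Complex.I * ν) * p1 - (w + a) * q1 + starRingEnd ℂ b * q2
          + (w + Complex.I * μ) * r1 + (w + e) * s1 - starRingEnd ℂ f * s2
          - w * x₃ k * t1 + w * y₃ k * t2')
      (by
        simp only [map_mul, map_add, map_sub, Complex.conj_conj]
        linear_combination -(w + Complex.I * ν) * p2 - (w + starRingEnd ℂ a) * q2 - b * q1
          + (w + Complex.I * μ) * r2 + (w + starRingEnd ℂ e) * s2 + f * s1
          - w * x₃ k * t2 - w * y₃ k * t1') hk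
    exact ⟨sub_eq_zero.1 q.1, sub_eq_zero.1 q.2⟩

lemma shift {N : ℕ} (l : Fin N → ℂ) (κ : ℂ) (h1 : ∀ k, l k ≠ κ) (h2 : ∀ k, l k ≠ -κ) (m : ℤ) :
    diagonal (fun k => ((l k + κ) / (l k - κ)) ^ (m + 1)) * diagonal (fun k => l k - κ)
      = diagonal (fun k => ((l k + κ) / (l k - κ)) ^ m) * diagonal (fun k => l k + κ) := by
  rw [diagonal_mul_diagonal, diagonal_mul_diagonal]
  congr 1
  ext k
  have e1 : l k - κ ≠ 0 := sub_ne_zero.2 (h1 k)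
  have e2 : l k + κ ≠ 0 := fun h => h2 k (eq_neg_of_add_eq_zero_left h)
  rw [zpow_add_one₀ (div_ne_zero e2 e1), mul_assoc, div_mul_cancel₀ _ e1]

lemma real_final (μ ν : ℝ) (p q r s : Fin 3 → ℝ)
    (n1 : (q 2 - p 2) ^ 2 + (q 0 - p 0) ^ 2 + (q 1 - p 1) ^ 2 = μ ^ 2)
    (n2 : (r 2 - p 2) ^ 2 + (r 0 - p 0) ^ 2 + (r 1 - p 1) ^ 2 = ν ^ 2)
    (c0 : (s 2 - q 2) * (q 2 - p 2) + (s 0 - q 0) * (q 0 - p 0) + (s 1 - q 1) * (q 1 - p 1)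
      = (s 2 - r 2) * (r 2 - p 2) + (s 0 - r 0) * (r 0 - p 0) + (s 1 - r 1) * (r 1 - p 1))
    (c1 : (s 0 - q 0) * (q 1 - p 1) - (s 1 - q 1) * (q 0 - p 0)
      = (s 0 - r 0) * (r 1 - p 1) - (s 1 - r 1) * (r 0 - p 0))
    (c2 : (s 2 - q 2) * (q 0 - p 0) - (s 0 - q 0) * (q 2 - p 2)
      = (s 2 - r 2) * (r 0 - p 0) - (s 0 - r 0) * (r 2 - p 2))
    (c3 : (s 2 - q 2) * (q 1 - p 1) - (s 1 - q 1) * (q 2 - p 2)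
      = (s 2 - r 2) * (r 1 - p 1) - (s 1 - r 1) * (r 2 - p 2)) (i : Fin 3) :
    ((s 0 - p 0) ^ 2 + (s 1 - p 1) ^ 2 + (s 2 - p 2) ^ 2) * (q i - r i)
      = (μ ^ 2 - ν ^ 2) * (s i - p i) := by
  have d0 : (s 0 - p 0) * (q 0 - r 0) + (s 1 - p 1) * (q 1 - r 1) + (s 2 - p 2) * (q 2 - r 2)
      = μ ^ 2 - ν ^ 2 := by linear_combination c0 + n1 - n2
  have d1 : (s 0 - p 0) * (q 1 - r 1) - (s 1 - p 1) * (q 0 - r 0) = 0 := by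
    linear_combination c1
  have d2 : (s 2 - p 2) * (q 0 - r 0) - (s 0 - p 0) * (q 2 - r 2) = 0 := by
    linear_combination c2
  have d3 : (s 2 - p 2) * (q 1 - r 1) - (s 1 - p 1) * (q 2 - r 2) = 0 := by
    linear_combination c3
  fin_cases i
  · simp only [Fin.zero_eta]
    linear_combination (s 0 - p 0) * d0 - (s 1 - p 1) * d1 + (s 2 - p 2) * d2
  · simp only [Fin.mk_one]
    linear_combination (s 1 - p 1) * d0 + (s 0 - p 0) * d1 + (s 2 - p 2) * d3
  · simp only [Fin.reduceFinMk]
    linear_combination (s 2 - p 2) * d0 - (s 0 - p 0) * d2 - (s 1 - p 1) * d3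

end SolitonAux

/-- Proposition 3.1, lattice realization: the field
`φ_{m,n} = (Re q_{m,n}, Im q_{m,n}, Im p_{m,n} + mμ + nν)` built from the soliton matrices
`A_{m,n} = A·H_μ^m·H_ν^n` satisfies the auxiliary vector relation
`φ_{m+1,n} − φ_{m,n+1} = (μ² − ν²)·(φ_{m+1,n+1} − φ_{m,n})/‖φ_{m+1,n+1} − φ_{m,n}‖²`. -/
theorem soliton_auxiliary_lattice_system (N : ℕ) (hN : 1 ≤ N)
    (l ℓv β : Fin N → ℂ) (A : Matrix (Fin N) (Fin N) ℂ)
    (hrank : (Matrix.diagonal (fun k => starRingEnd ℂ (l k)) - Matrix.vecMulVec ℓv β) * A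
        = A * Matrix.diagonal l)
    (μ ν : ℝ) (hμν : μ ^ 2 ≠ ν ^ 2)
    (hL : ∀ k, l k ≠ Complex.I * μ ∧ l k ≠ -(Complex.I * μ)
        ∧ l k ≠ Complex.I * ν ∧ l k ≠ -(Complex.I * ν))
    (hden : ∀ ζ ∈ ({Complex.I * μ, Complex.I * ν} : Set ℂ),
      1 - β ⬝ᵥ ((Matrix.diagonal (fun k => starRingEnd ℂ (l k)) - ζ • 1)⁻¹ *ᵥ ℓv) ≠ 0
      ∧ 1 - star β ⬝ᵥ ((Matrix.diagonal l + ζ • 1)⁻¹ *ᵥ star ℓv) ≠ 0)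
    (Amn : ℤ → ℤ → Matrix (Fin N) (Fin N) ℂ)
    (hAmn : ∀ m n : ℤ, Amn m n
        = A * Matrix.diagonal (fun k => ((l k + Complex.I * μ) / (l k - Complex.I * μ)) ^ m)
            * Matrix.diagonal (fun k => ((l k + Complex.I * ν) / (l k - Complex.I * ν)) ^ n))
    (hGmn : ∀ m n : ℤ, IsUnit (1 + Amn m n * (Amn m n).map (starRingEnd ℂ)))
    (φ : ℤ → ℤ → EuclideanSpace ℝ (Fin 3))
    (hφ : ∀ m n : ℤ, φ m n = (WithLp.equiv 2 (Fin 3 → ℝ)).symm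
      ![(β ⬝ᵥ ((1 + Amn m n * (Amn m n).map (starRingEnd ℂ))⁻¹ *ᵥ (Amn m n *ᵥ star ℓv))).re,
        (β ⬝ᵥ ((1 + Amn m n * (Amn m n).map (starRingEnd ℂ))⁻¹ *ᵥ (Amn m n *ᵥ star ℓv))).im,
        (1 - β ⬝ᵥ ((1 + Amn m n * (Amn m n).map (starRingEnd ℂ))⁻¹ *ᵥ ℓv)).im
          + (m : ℝ) * μ + (n : ℝ) * ν]) :
    ∀ m n : ℤ, φ (m + 1) (n + 1) ≠ φ m n →
      φ (m + 1) n - φ m (n + 1)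
        = ((μ ^ 2 - ν ^ 2) / ‖φ (m + 1) (n + 1) - φ m n‖ ^ 2) •
            (φ (m + 1) (n + 1) - φ m n) := by
  intro m n hne
  have hr : ∀ m n : ℤ, (Matrix.diagonal (fun k => starRingEnd ℂ (l k)) - Matrix.vecMulVec ℓv β)
      * Amn m n = Amn m n * Matrix.diagonal l := by
    intro m n
    rw [hAmn, ← Matrix.mul_assoc, ← Matrix.mul_assoc, hrank]
    simp only [Matrix.mul_assoc, diagonal_mul_diagonal]
    congr 3
    ext k
    ring
  have s1 : ∀ m n : ℤ, Amn (m + 1) n * diagonal (fun k => l k - Complex.I * μ)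
      = Amn m n * diagonal (fun k => l k + Complex.I * μ) := by
    intro m n
    have e := SolitonAux.shift l (Complex.I * μ) (fun k => (hL k).1) (fun k => (hL k).2.1) m
    have cm : ∀ a b : Fin N → ℂ, diagonal a * diagonal b = diagonal b * diagonal a := by
      intro a b
      simp only [diagonal_mul_diagonal, mul_comm]
    rw [hAmn, hAmn, Matrix.mul_assoc, Matrix.mul_assoc (A * _), cm, cm _ (fun k => l k + _),
      ← Matrix.mul_assoc, ← Matrix.mul_assoc, Matrix.mul_assoc A, e]
    simp only [Matrix.mul_assoc]
  have s2 : ∀ m n : ℤ, Amn m (n + 1) * diagonal (fun k => l k - Complex.I * ν)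
      = Amn m n * diagonal (fun k => l k + Complex.I * ν) := by
    intro m n
    have e := SolitonAux.shift l (Complex.I * ν) (fun k => (hL k).2.2.1)
      (fun k => (hL k).2.2.2) n
    rw [hAmn, hAmn, Matrix.mul_assoc, Matrix.mul_assoc (A * _), e]
  obtain ⟨x, y, S, ex, ey⟩ := SolitonAux.exists_sol (Amn m n) (hGmn m n) ℓv
  obtain ⟨x₁, y₁, S₁, ex₁, ey₁⟩ := SolitonAux.exists_sol (Amn (m + 1) n) (hGmn (m + 1) n) ℓv
  obtain ⟨x₂, y₂, S₂, ex₂, ey₂⟩ := SolitonAux.exists_sol (Amn m (n + 1)) (hGmn m (n + 1)) ℓv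
  obtain ⟨x₃, y₃, S₃, ex₃, ey₃⟩ :=
    SolitonAux.exists_sol (Amn (m + 1) (n + 1)) (hGmn (m + 1) (n + 1)) ℓv
  have N1 := SolitonAux.norm_step l ℓv β _ _ μ (hr m n) (hr (m + 1) n) (s1 m n) (hGmn _ _)
    (hGmn _ _) x y x₁ y₁ S S₁ _ _ rfl rfl
  have N2 := SolitonAux.norm_step l ℓv β _ _ ν (hr m n) (hr m (n + 1)) (s2 m n) (hGmn _ _)
    (hGmn _ _) x y x₂ y₂ S S₂ _ _ rfl rfl
  have N3 := SolitonAux.norm_step l ℓv β _ _ ν (hr (m + 1) n) (hr (m + 1) (n + 1)) (s2 (m + 1) n)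
    (hGmn _ _) (hGmn _ _) x₁ y₁ x₃ y₃ S₁ S₃ _ _ rfl rfl
  have N4 := SolitonAux.norm_step l ℓv β _ _ μ (hr m (n + 1)) (hr (m + 1) (n + 1)) (s1 m (n + 1))
    (hGmn _ _) (hGmn _ _) x₂ y₂ x₃ y₃ S₂ S₃ _ _ rfl rfl
  have C := SolitonAux.compat l ℓv β _ _ _ _ μ ν (hr m n) (hr (m + 1) n) (hr m (n + 1))
    (hr (m + 1) (n + 1)) (s1 m n) (s2 m n) (s2 (m + 1) n) (s1 m (n + 1)) (hGmn _ _) (hGmn _ _)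
    (hGmn _ _) (hGmn _ _) x y x₁ y₁ x₂ y₂ x₃ y₃ S S₁ S₂ S₃ _ _ _ _ _ _ _ _ rfl rfl rfl rfl rfl rfl
    rfl rfl
  have P := hφ m n
  have P₁ := hφ (m + 1) n
  have P₂ := hφ m (n + 1)
  have P₃ := hφ (m + 1) (n + 1)
  rw [ex, ey] at P
  rw [ex₁, ey₁] at P₁
  rw [ex₂, ey₂] at P₂
  rw [ex₃, ey₃] at P₃
  simp only [dotProduct_neg] at P P₁ P₂ P₃
  generalize β ⬝ᵥ x = X, β ⬝ᵥ x₁ = X₁, β ⬝ᵥ x₂ = X₂, β ⬝ᵥ x₃ = X₃, β ⬝ᵥ y = Y, β ⬝ᵥ y₁ = Y₁,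
    β ⬝ᵥ y₂ = Y₂, β ⬝ᵥ y₃ = Y₃ at *
  obtain ⟨r1, n1⟩ := N1
  obtain ⟨r2, n2⟩ := N2
  obtain ⟨r3, -⟩ := N3
  obtain ⟨r4, -⟩ := N4
  obtain ⟨C1, C2⟩ := C
  have c0 := congrArg Complex.re C1
  have c1 := congrArg Complex.im C1
  have c2 := congrArg Complex.re C2
  have c3 := congrArg Complex.im C2
  simp only [Complex.mul_re, Complex.mul_im, Complex.sub_re, Complex.sub_im, Complex.add_re,
    Complex.add_im, Complex.conj_re, Complex.conj_im, Complex.I_re, Complex.I_im,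
    Complex.ofReal_re, Complex.ofReal_im, zero_mul, mul_zero, one_mul, sub_zero, zero_add,
    add_zero] at r1 r2 r3 r4 n1 n2 c0 c1 c2 c3
  have e1 : X₁.re = X.re := by linarith
  have e2 : X₂.re = X.re := by linarith
  have e3 : X₃.re = X.re := by linarith
  rw [e1, e2, e3] at c0 c1 c2 c3
  have key := SolitonAux.real_final μ ν (φ m n) (φ (m + 1) n) (φ m (n + 1)) (φ (m + 1) (n + 1))
    (by rw [P, P₁]; simp; linear_combination n1)
    (by rw [P, P₂]; simp; linear_combination n2)
    (by rw [P, P₁, P₂, P₃]; simp; linear_combination -c0)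
    (by rw [P, P₁, P₂, P₃]; simp; linear_combination c1)
    (by rw [P, P₁, P₂, P₃]; simp; linear_combination c3)
    (by rw [P, P₁, P₂, P₃]; simp; linear_combination -c2)
  have hnorm : ‖φ (m + 1) (n + 1) - φ m n‖ ^ 2 = (φ (m + 1) (n + 1) 0 - φ m n 0) ^ 2
      + (φ (m + 1) (n + 1) 1 - φ m n 1) ^ 2 + (φ (m + 1) (n + 1) 2 - φ m n 2) ^ 2 := by
    rw [EuclideanSpace.norm_sq_eq, Fin.sum_univ_three]
    simp
  have hpos : ‖φ (m + 1) (n + 1) - φ m n‖ ^ 2 ≠ 0 :=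
    pow_ne_zero 2 (norm_ne_zero_iff.2 (sub_ne_zero.2 hne))
  ext i
  have := key i
  rw [← hnorm] at this
  simp only [PiLp.sub_apply, PiLp.smul_apply, smul_eq_mul]
  rw [div_mul_eq_mul_div, eq_div_iff hpos, ← this]
  ring
end

section
/- (Proposition 4.1: N-soliton solutions of the vector lattice KdV equation.) Fix real numbers μ, ν with μ² ≠ ν² such that L_k ∉ {iμ, −iμ, iν, −iν} for all k, and assume 1 − β(conj(diag L) − ζ)⁻¹ℓ ≠ 0 and 1 − conj(β)(diag L + ζ)⁻¹ℓ ≠ 0 for ζ ∈ {iμ, iν}. For (m,n) ∈ ℤ² set A_{m,n} = A·H_μ^m·H_ν^n, assume 1 + A_{m,n}·conj(A_{m,n}) is invertible with inverse G_{m,n}, and define φ_{m,n} ∈ ℝ³ by φ_{m,n} = ((mμ + nν)/√|μ² − ν²|)·(0,0,1)ᵀ + (1/√|μ² − ν²|)·( Re(β·G_{m,n}·A_{m,n}·ℓ), Im(β·G_{m,n}·A_{m,n}·ℓ), −Im(β·G_{m,n}·ℓ) )ᵀ. Then for every (m,n) with φ_{m+1,n+1} ≠ φ_{m,n} and φ_{m+1,n}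 ≠ φ_{m,n+1}, the field φ satisfies the vector lattice KdV equation ‖φ_{m+1,n+1} − φ_{m,n}‖ · ‖φ_{m+1,n} − φ_{m,n+1}‖ = 1. -/
open Matrix

/-- Intertwining relation between the resolvents at two neighbouring lattice sites. -/
theorem aux_inter {S : Type*} [Ring S] (J R J1 R1 P C : S)
    (hR : (1 - J) * R = 1) (hR1 : R1 * (1 - J1) = 1) (h : J1 * P = (P - C) * J) :
    P * R = R1 * (P - C) + R1 * C * R := by
  have h1 : (1 - J1) * P = (P - C) * (1 - J) + C := by
    rw [sub_mul, h]; noncomm_ring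
  calc P * R = (R1 * (1 - J1)) * P * R := by rw [hR1, one_mul]
    _ = R1 * ((1 - J1) * P) * R := by noncomm_ring
    _ = R1 * (P - C) * ((1 - J) * R) + R1 * C * R := by rw [h1]; noncomm_ring
    _ = _ := by rw [hR, mul_one]

section
variable {n : Type*} [Fintype n] [DecidableEq n]

/-- The Lax relation. -/
theorem aux_lax (X s J R J1 R1 : Matrix n n ℂ) (s2 : Matrix (Fin 2) (Fin 2) ℂ)
    (b : Matrix (Fin 2) n ℂ) (l : Matrix n (Fin 2) ℂ)
    (hR' : R * (1 - J) = 1) (hR : (1 - J) * R = 1) (hR1 : R1 * (1 - J1) = 1)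
    (hJ : J * X = (X - l * b) * J) (hJ1 : J1 * (X + s) = (X + s - l * b) * J)
    (hs : b * s = s2 * b) :
    (b * R1 * J1) * (X + s)
      = (s2 + b * R * l - b * R1 * l) * (b * R * J) + (b * R * J) * X := by
  have e1 := aux_inter J R J1 R1 (X + s) (l * b) hR hR1 hJ1
  have e2 := aux_inter J R J R X (l * b) hR hR' hJ
  have f1 : b * ((X + s) * R) * J = b * R1 * J1 * (X + s) + b * R1 * l * (b * R * J) := by
    rw [e1, Matrix.mul_assoc (b * R1), hJ1]
    simp only [Matrix.mul_add, Matrix.add_mul, Matrix.mul_assoc]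
  have f2 : b * (X * R) * J = b * R * J * X + b * R * l * (b * R * J) := by
    rw [e2, Matrix.mul_assoc (b * R) J, hJ]
    simp only [Matrix.mul_add, Matrix.add_mul, Matrix.mul_assoc]
  have f3 : b * ((X + s) * R) * J = b * (X * R) * J + s2 * (b * R * J) := by
    rw [Matrix.add_mul, Matrix.mul_add, Matrix.add_mul, ← Matrix.mul_assoc b s, hs]
    simp only [Matrix.mul_assoc]
  have f4 : b * R1 * J1 * (X + s) = b * R * J * X + b * R * l * (b * R * J)
      + s2 * (b * R * J) - b * R1 * l * (b * R * J) := by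
    rw [← f2, ← f3, f1]; abel
  rw [f4, Matrix.sub_mul, Matrix.add_mul]; abel

theorem aux_theta (X Q J R : Matrix n n ℂ)
    (b : Matrix (Fin 2) n ℂ) (l : Matrix n (Fin 2) ℂ)
    (hR' : R * (1 - J) = 1) (hR : (1 - J) * R = 1)
    (hJ : J * X = (X - l * b) * J) (hQ : Q * X = 1) :
    (1 + (b * R * J) * Q * l).det = 1 := by
  have e2 := aux_inter J R J R X (l * b) hR hR' hJ
  have hRJ : R * J = R - 1 := by
    rw [mul_sub, mul_one] at hR'
    rw [← hR']; abel
  have h3 : (1 - J) * (X * R) = X + l * (b * R * J) := by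
    rw [e2, mul_add, ← mul_assoc, hR, mul_assoc R, ← mul_assoc, hR, one_mul, one_mul,
      Matrix.mul_assoc b, hRJ, Matrix.mul_sub, Matrix.mul_sub, Matrix.mul_one,
      Matrix.mul_assoc l]
    abel
  have hd : (1 - J).det * R.det = 1 := by rw [← det_mul, hR, det_one]
  have hdX : Q.det * X.det = 1 := by rw [← det_mul, hQ, det_one]
  have hX0 : X.det ≠ 0 := fun h => by simp [h] at hdX
  rw [Matrix.det_one_add_mul_comm]
  have h4 : (1 + l * (b * R * J * Q)) * X = (1 - J) * (X * R) := by
    rw [h3, Matrix.add_mul, Matrix.one_mul, Matrix.mul_assoc l, Matrix.mul_assoc _ Q, hQ,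
      Matrix.mul_one]
  have h5 := congrArg det h4
  rw [det_mul, det_mul, det_mul] at h5
  apply mul_right_cancel₀ hX0
  rw [h5, one_mul]
  linear_combination X.det * hd

theorem aux_det_s13 (X s J R J1 R1 : Matrix n n ℂ) (s2 : Matrix (Fin 2) (Fin 2) ℂ)
    (b : Matrix (Fin 2) n ℂ) (l : Matrix n (Fin 2) ℂ)
    (hR' : R * (1 - J) = 1) (hR : (1 - J) * R = 1)
    (hR1' : R1 * (1 - J1) = 1) (hR1 : (1 - J1) * R1 = 1)
    (hJ : J * X = (X - l * b) * J) (hJ1 : J1 * (X + s) = (X + s - l * b) * J)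
    (hJ11 : J1 * X = (X - l * b) * J1)
    (hs : b * s = s2 * b) (hs' : s * l = l * s2) (hX : IsUnit X.det) (hc : s * X = X * s) :
    (s2 + b * R * l - b * R1 * l).det = s2.det := by
  have hQ : X⁻¹ * X = 1 := Matrix.nonsing_inv_mul X hX
  have hQ' : X * X⁻¹ = 1 := Matrix.mul_nonsing_inv X hX
  have t := aux_theta X X⁻¹ J R b l hR' hR hJ hQ
  have t1 := aux_theta X X⁻¹ J1 R1 b l hR1' hR1 hJ11 hQ
  have hl := aux_lax X s J R J1 R1 s2 b l hR' hR hR1' hJ hJ1 hs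
  generalize hQd : X⁻¹ = Q at *
  have hcQ : Q * s = s * Q := by
    calc Q * s = Q * s * (X * Q) := by rw [hQ', mul_one]
      _ = Q * (s * X) * Q := by noncomm_ring
      _ = (Q * X) * s * Q := by rw [hc]; noncomm_ring
      _ = s * Q := by rw [hQ, one_mul]
  have y : ∀ (J R : Matrix n n ℂ), R * (1 - J) = 1 → b * R * J * l = b * R * l - b * l := by
    intro J R hR'
    have hRJ : R * J = R - 1 := by
      rw [mul_sub, mul_one] at hR'
      rw [← hR']; abel
    rw [Matrix.mul_assoc b, hRJ, Matrix.mul_sub, Matrix.sub_mul, Matrix.mul_one]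
  have y0 := y J R hR'
  have y1 := y J1 R1 hR1'
  have key : (1 + (b * R1 * J1) * Q * l) * s2
      = (s2 + b * R * l - b * R1 * l) * (1 + (b * R * J) * Q * l) := by
    have k1 : (b * R1 * J1) * Q * l * s2 = (b * R1 * J1) * (X + s) * Q * l - b * R1 * J1 * l := by
      rw [Matrix.mul_assoc _ l, ← hs', ← Matrix.mul_assoc _ s, Matrix.mul_assoc _ Q, hcQ,
        Matrix.mul_add, Matrix.add_mul _ _ Q, Matrix.mul_assoc _ X, hQ', Matrix.mul_one,
        Matrix.add_mul, Matrix.mul_assoc _ s]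
      abel
    rw [Matrix.add_mul, k1, hl, Matrix.one_mul, Matrix.mul_add, Matrix.mul_one, Matrix.add_mul,
      Matrix.mul_assoc _ X, hQ', Matrix.mul_one, Matrix.add_mul, y0, y1]
    simp only [Matrix.mul_assoc]
    abel
  have := congrArg det key
  rw [det_mul, det_mul, t, t1, one_mul, mul_one] at this
  exact this.symm

/-- Trace and determinant of the Lax matrix. -/
theorem aux_tr (X s J R J1 R1 : Matrix n n ℂ) (s2 : Matrix (Fin 2) (Fin 2) ℂ)
    (b : Matrix (Fin 2) n ℂ) (l : Matrix n (Fin 2) ℂ)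
    (hR' : R * (1 - J) = 1) (hR : (1 - J) * R = 1)
    (hR1' : R1 * (1 - J1) = 1) (hR1 : (1 - J1) * R1 = 1)
    (hJ : J * X = (X - l * b) * J) (hJ1 : J1 * (X + s) = (X + s - l * b) * J)
    (hJ11 : J1 * X = (X - l * b) * J1)
    (hs : b * s = s2 * b) (hs' : s * l = l * s2) (hX : IsUnit X.det) (hX1 : IsUnit (X - 1).det)
    (hc : s * X = X * s) :
    (s2 + b * R * l - b * R1 * l).det = s2.det ∧
    (s2 + b * R * l - b * R1 * l).trace = s2.trace := by
  have h0 := aux_det_s13 X s J R J1 R1 s2 b l hR' hR hR1' hR1 hJ hJ1 hJ11 hs hs' hX hc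
  have h1 := aux_det_s13 (X - 1) (s + 1) J R J1 R1 (s2 + 1) b l hR' hR hR1' hR1
    (by rw [mul_sub, hJ]; noncomm_ring)
    (by rw [show X - 1 + (s + 1) = X + s by abel]; exact hJ1)
    (by rw [mul_sub, hJ11]; noncomm_ring)
    (by rw [Matrix.mul_add, hs, Matrix.add_mul, Matrix.mul_one, Matrix.one_mul])
    (by rw [Matrix.add_mul, hs', Matrix.mul_add, Matrix.mul_one, Matrix.one_mul])
    hX1 (by rw [add_mul, mul_sub, hc]; noncomm_ring)
  refine ⟨h0, ?_⟩
  generalize b * R * l = B at *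
  generalize b * R1 * l = B1 at *
  simp only [det_fin_two, trace_fin_two, Matrix.add_apply, Matrix.sub_apply,
    Matrix.one_apply_eq, Matrix.one_apply_ne, ne_eq, zero_ne_one, one_ne_zero, not_false_eq_true]
    at h0 h1 ⊢
  linear_combination h1 - h0

end

theorem aux_ch (U : Matrix (Fin 2) (Fin 2) ℂ) (h : U.trace = 0) : U * U = (-U.det) • 1 := by
  rw [trace_fin_two] at h
  have h' : U 1 1 = - U 0 0 := by linear_combination h
  ext i j
  fin_cases i <;> fin_cases j <;> simp [Matrix.mul_apply, det_fin_two, h'] <;> ring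

/-- Closing the elementary square. -/
theorem aux_square (U V U2 V1 : Matrix (Fin 2) (Fin 2) ℂ) (u v : ℂ)
    (hU : U.trace = 0) (hV : V.trace = 0) (hdU : U.det = u) (hdV : V.det = v)
    (hsum : U2 + V = V1 + U) (hprod : U2 * V = V1 * U) :
    (U2 + V).det * (U - V).det = (u - v) ^ 2 := by
  have e : (U2 + V) * (U - V) = (v - u) • 1 := by
    calc (U2 + V) * (U - V) = (U2 + V) * U - (U2 + V) * V := by rw [mul_sub]
      _ = (V1 + U) * U - (U2 + V) * V := by rw [hsum]
      _ = U * U - V * V := by rw [add_mul, add_mul, hprod]; abel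
      _ = _ := by
        rw [aux_ch U hU, aux_ch V hV, hdU, hdV, ← sub_smul]; congr 1; ring
  rw [← det_mul, e, det_smul]
  simp
  ring

section
variable {N : ℕ}

def auxB (β : Fin N → ℂ) : Matrix (Fin 2) (Fin N ⊕ Fin N) ℂ :=
  Matrix.of ![Sum.elim β 0, Sum.elim 0 (star β)]

def auxL (N : ℕ) : Matrix (Fin N ⊕ Fin N) (Fin 2) ℂ :=
  Matrix.of (Sum.elim (fun _ => ![1, 0]) (fun _ => ![0, 1]))

def auxJ (A : Matrix (Fin N) (Fin N) ℂ) : Matrix (Fin N ⊕ Fin N) (Fin N ⊕ Fin N) ℂ :=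
  fromBlocks 0 A (-A.map (starRingEnd ℂ)) 0

def auxR (A G : Matrix (Fin N) (Fin N) ℂ) : Matrix (Fin N ⊕ Fin N) (Fin N ⊕ Fin N) ℂ :=
  fromBlocks G (G * A) (-(G.map (starRingEnd ℂ) * A.map (starRingEnd ℂ))) (G.map (starRingEnd ℂ))

def auxX (L : Fin N → ℂ) : Matrix (Fin N ⊕ Fin N) (Fin N ⊕ Fin N) ℂ :=
  diagonal (Sum.elim (fun k => starRingEnd ℂ (L k)) L)

def auxS (N : ℕ) (z : ℂ) : Matrix (Fin N ⊕ Fin N) (Fin N ⊕ Fin N) ℂ :=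
  diagonal (Sum.elim (fun _ => z) (fun _ => -z))

theorem auxR_mul (A G : Matrix (Fin N) (Fin N) ℂ)
    (hG : G * (1 + A * A.map (starRingEnd ℂ)) = 1) : auxR A G * (1 - auxJ A) = 1 := by
  have hG2 : G.map (starRingEnd ℂ) * (1 + A.map (starRingEnd ℂ) * A) = 1 := by
    have := congrArg (fun M => M.map (starRingEnd ℂ)) hG
    simp only [Matrix.map_mul] at this
    rw [Matrix.map_add _ (by simp), Matrix.map_mul, Matrix.map_map] at this
    simpa [Function.comp_def] using this
  have h1 : (1 : Matrix (Fin N ⊕ Fin N) (Fin N ⊕ Fin N) ℂ) - auxJ A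
      = fromBlocks 1 (-A) (A.map (starRingEnd ℂ)) 1 := by
    rw [auxJ, ← fromBlocks_one, sub_eq_add_neg, fromBlocks_neg, fromBlocks_add]; simp
  rw [h1, auxR, fromBlocks_multiply, ← fromBlocks_one]
  rw [mul_add, mul_one] at hG hG2
  congr 1
  · rw [mul_one, mul_assoc, hG]
  · simp
  · simp
  · refine Eq.trans ?_ hG2
    simp [mul_assoc, add_comm]

theorem auxB_auxS (β : Fin N → ℂ) (z : ℂ) :
    auxB β * auxS N z = !![z, 0; 0, -z] * auxB β := by
  ext i j
  fin_cases i <;> rcases j with j | j <;>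
    simp [auxB, auxS, Matrix.diagonal_apply, Matrix.mul_apply, Fin.sum_univ_two, mul_comm]

theorem auxS_auxL (z : ℂ) :
    auxS N z * auxL N = auxL N * !![z, 0; 0, -z] := by
  ext i j
  fin_cases j <;> rcases i with i | i <;>
    simp [auxL, auxS, Matrix.diagonal_apply, Matrix.mul_apply, Fin.sum_univ_two, mul_comm]

theorem auxL_auxB (β : Fin N → ℂ) : auxL N * auxB β
    = fromBlocks (Matrix.of fun _ k => β k) 0 0 (Matrix.of fun _ k => star (β k)) := by
  ext i j
  rcases j with j | j <;> rcases i with i | i <;>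
    simp [auxL, auxB, Matrix.mul_apply, Fin.sum_univ_two]

theorem auxPhi (β : Fin N → ℂ) (A G : Matrix (Fin N) (Fin N) ℂ) :
    auxB β * auxR A G * auxL N
      = !![β ⬝ᵥ (G *ᵥ (fun _ => 1)), β ⬝ᵥ (G *ᵥ (A *ᵥ (fun _ => 1)));
          -(starRingEnd ℂ) (β ⬝ᵥ (G *ᵥ (A *ᵥ (fun _ => 1)))),
          (starRingEnd ℂ) (β ⬝ᵥ (G *ᵥ (fun _ => 1)))] := by
  have e1 : ∀ M : Matrix (Fin N) (Fin N) ℂ,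
      β ⬝ᵥ (M *ᵥ (fun _ => 1)) = ∑ i, ∑ j, β i * M i j := by
    intro M; simp [dotProduct, mulVec, Finset.mul_sum]
  rw [mulVec_mulVec, e1, e1]
  rw [Matrix.mul_assoc]
  ext i j
  fin_cases i <;> fin_cases j <;>
    simp [auxB, auxR, auxL, Matrix.mul_apply (M := Matrix.of _), Fintype.sum_sum_type,
      Matrix.mul_apply (M := fromBlocks _ _ _ _), Finset.mul_sum, ← Matrix.map_mul]

theorem auxJ_auxX (L : Fin N → ℂ) (β : Fin N → ℂ) (A : Matrix (Fin N) (Fin N) ℂ)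
    (h : ∀ j k, starRingEnd ℂ (L j) * A j k - A j k * L k = (β ᵥ* A) k) :
    auxJ A * auxX L = (auxX L - auxL N * auxB β) * auxJ A := by
  rw [sub_mul, auxL_auxB]
  ext i j
  rcases j with j | j <;> rcases i with i | i <;>
    simp [auxX, auxJ, Matrix.diagonal_apply, Matrix.diagonal_mul,
      Matrix.mul_apply (M := fromBlocks _ _ _ _), Fintype.sum_sum_type]
  · have := congrArg (starRingEnd ℂ) (h i j)
    simp [vecMul, dotProduct] at this
    linear_combination this
  · have := h i j
    simp [vecMul, dotProduct] at this
    linear_combination -this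

theorem auxJ_step (L : Fin N → ℂ) (β : Fin N → ℂ) (A A1 : Matrix (Fin N) (Fin N) ℂ) (t : ℝ)
    (h : ∀ j k, starRingEnd ℂ (L j) * A j k - A j k * L k = (β ᵥ* A) k)
    (h1 : ∀ j k, A1 j k * (L k - Complex.I * t) = A j k * (L k + Complex.I * t)) :
    auxJ A1 * (auxX L + auxS N (Complex.I * t))
      = (auxX L + auxS N (Complex.I * t) - auxL N * auxB β) * auxJ A := by
  have e : (auxX L + auxS N (Complex.I * t) - auxL N * auxB β) * auxJ A
      = auxJ A * (auxX L - auxS N (Complex.I * t)) := by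
    have : auxS N (Complex.I * t) * auxJ A = - (auxJ A * auxS N (Complex.I * t)) := by
      ext i j
      rcases j with j | j <;> rcases i with i | i <;>
        simp [auxS, auxJ, Matrix.mul_diagonal, Matrix.diagonal_mul, mul_comm]
    rw [show auxX L + auxS N (Complex.I * t) - auxL N * auxB β
      = (auxX L - auxL N * auxB β) + auxS N (Complex.I * t) by abel, add_mul, this,
      ← auxJ_auxX L β A h, mul_sub]
    abel
  rw [e]
  ext i j
  rcases j with j | j <;> rcases i with i | i <;>
    simp [auxX, auxS, auxJ, mul_add, mul_sub, Matrix.mul_diagonal]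
  · have := congrArg (starRingEnd ℂ) (h1 i j)
    simp at this
    linear_combination -this
  · linear_combination h1 i j

end

/-- The elementary square in terms of the resolvent data. -/
theorem aux_main {N : ℕ} (L β : Fin N → ℂ) (hL : ∀ j, starRingEnd ℂ (L j) ≠ L j)
    (k₀ : Fin N) (hβ : β k₀ ≠ 0) (μ ν : ℝ)
    (A A1 A2 A3 G G1 G2 G3 : Matrix (Fin N) (Fin N) ℂ) (hA : IsUnit A)
    (hG : G * (1 + A * A.map (starRingEnd ℂ)) = 1)
    (hG1 : G1 * (1 + A1 * A1.map (starRingEnd ℂ)) = 1)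
    (hG2 : G2 * (1 + A2 * A2.map (starRingEnd ℂ)) = 1)
    (hG3 : G3 * (1 + A3 * A3.map (starRingEnd ℂ)) = 1)
    (h0 : ∀ j k, starRingEnd ℂ (L j) * A j k - A j k * L k = (β ᵥ* A) k)
    (h1 : ∀ j k, starRingEnd ℂ (L j) * A1 j k - A1 j k * L k = (β ᵥ* A1) k)
    (h2 : ∀ j k, starRingEnd ℂ (L j) * A2 j k - A2 j k * L k = (β ᵥ* A2) k)
    (h3 : ∀ j k, starRingEnd ℂ (L j) * A3 j k - A3 j k * L k = (β ᵥ* A3) k)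
    (h01 : ∀ j k, A1 j k * (L k - Complex.I * μ) = A j k * (L k + Complex.I * μ))
    (h02 : ∀ j k, A2 j k * (L k - Complex.I * ν) = A j k * (L k + Complex.I * ν))
    (h13 : ∀ j k, A3 j k * (L k - Complex.I * ν) = A1 j k * (L k + Complex.I * ν))
    (h23 : ∀ j k, A3 j k * (L k - Complex.I * μ) = A2 j k * (L k + Complex.I * μ))
    (Φ Φ1 Φ2 Φ3 S T : Matrix (Fin 2) (Fin 2) ℂ)
    (hΦ : Φ = auxB β * auxR A G * auxL N) (hΦ1 : Φ1 = auxB β * auxR A1 G1 * auxL N)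
    (hΦ2 : Φ2 = auxB β * auxR A2 G2 * auxL N) (hΦ3 : Φ3 = auxB β * auxR A3 G3 * auxL N)
    (hS : S = !![Complex.I * μ, 0; 0, -(Complex.I * μ)])
    (hT : T = !![Complex.I * ν, 0; 0, -(Complex.I * ν)]) :
    (S + T + Φ - Φ3).det * (S - T + Φ2 - Φ1).det = ((μ : ℂ) ^ 2 - (ν : ℂ) ^ 2) ^ 2 ∧
    (S + T + Φ - Φ3).trace = 0 ∧ (S - T + Φ2 - Φ1).trace = 0 := by
  have r := auxR_mul A G hG
  have r1 := auxR_mul A1 G1 hG1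
  have r2 := auxR_mul A2 G2 hG2
  have r3 := auxR_mul A3 G3 hG3
  have r' := mul_eq_one_comm.mp r
  have r1' := mul_eq_one_comm.mp r1
  have r2' := mul_eq_one_comm.mp r2
  have r3' := mul_eq_one_comm.mp r3
  have x := auxJ_auxX L β A h0
  have x1 := auxJ_auxX L β A1 h1
  have x2 := auxJ_auxX L β A2 h2
  have x3 := auxJ_auxX L β A3 h3
  have y01 := auxJ_step L β A A1 μ h0 h01
  have y02 := auxJ_step L β A A2 ν h0 h02
  have y13 := auxJ_step L β A1 A3 ν h1 h13
  have y23 := auxJ_step L β A2 A3 μ h2 h23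
  have sS := auxB_auxS β (Complex.I * μ)
  have sT := auxB_auxS β (Complex.I * ν)
  have sS' := auxS_auxL (N := N) (Complex.I * μ)
  have sT' := auxS_auxL (N := N) (Complex.I * ν)
  rw [← hS] at sS sS'
  rw [← hT] at sT sT'
  have im0 : ∀ j, (L j).im ≠ 0 := fun j hj => hL j (Complex.conj_eq_iff_im.mpr hj)
  have hX : IsUnit (auxX L).det := by
    rw [auxX, det_diagonal, isUnit_iff_ne_zero, Finset.prod_ne_zero_iff]
    rintro (j | j) - h <;> apply im0 j <;> have := congrArg Complex.im h <;> simpa using this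
  have hX1 : IsUnit (auxX L - 1).det := by
    rw [auxX, ← diagonal_one, diagonal_sub, det_diagonal, isUnit_iff_ne_zero,
      Finset.prod_ne_zero_iff]
    rintro (j | j) - h <;> apply im0 j <;> have := congrArg Complex.im h <;> simpa using this
  have cc : ∀ z, auxS N z * auxX L = auxX L * auxS N z := by
    intro z
    rw [auxS, auxX, diagonal_mul_diagonal, diagonal_mul_diagonal]
    congr 1; ext i; rw [mul_comm]
  have l01 := aux_lax _ _ _ _ _ _ S _ _ r r' r1 x y01 sS
  have l02 := aux_lax _ _ _ _ _ _ T _ _ r r' r2 x y02 sT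
  have l13 := aux_lax _ _ _ _ _ _ T _ _ r1 r1' r3 x1 y13 sT
  have l23 := aux_lax _ _ _ _ _ _ S _ _ r2 r2' r3 x2 y23 sS
  have d01 := aux_tr _ _ _ _ _ _ S _ _ r r' r1 r1' x y01 x1 sS sS' hX hX1 (cc _)
  have d02 := aux_tr _ _ _ _ _ _ T _ _ r r' r2 r2' x y02 x2 sT sT' hX hX1 (cc _)
  have d13 := aux_tr _ _ _ _ _ _ T _ _ r1 r1' r3 r3' x1 y13 x3 sT sT' hX hX1 (cc _)
  have d23 := aux_tr _ _ _ _ _ _ S _ _ r2 r2' r3 r3' x2 y23 x3 sS sS' hX hX1 (cc _)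
  rw [← hΦ, ← hΦ1] at l01 d01
  rw [← hΦ, ← hΦ2] at l02 d02
  rw [← hΦ1, ← hΦ3] at l13 d13
  rw [← hΦ2, ← hΦ3] at l23 d23
  have trS : S.trace = 0 := by rw [hS]; simp [trace_fin_two]
  have trT : T.trace = 0 := by rw [hT]; simp [trace_fin_two]
  have dS : S.det = (μ : ℂ) ^ 2 := by
    rw [hS]; simp [det_fin_two]; linear_combination (-(μ : ℂ) ^ 2) * Complex.I_sq
  have dT : T.det = (ν : ℂ) ^ 2 := by
    rw [hT]; simp [det_fin_two]; linear_combination (-(ν : ℂ) ^ 2) * Complex.I_sq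
  -- right inverse of `Y`
  obtain ⟨Z, hZ⟩ : ∃ Z : Matrix (Fin N ⊕ Fin N) (Fin 2) ℂ,
      auxB β * auxR A G * auxJ A * Z = 1 := by
    have hbz : ∃ Z0 : Matrix (Fin N ⊕ Fin N) (Fin 2) ℂ, auxB β * Z0 = 1 := by
      refine ⟨Matrix.of (Sum.elim (fun k => if k = k₀ then ![(β k₀)⁻¹, 0] else 0)
        (fun k => if k = k₀ then ![0, (star (β k₀))⁻¹] else 0)), ?_⟩
      ext i j
      fin_cases i <;> fin_cases j <;>
        simp [auxB, Matrix.mul_apply, Fintype.sum_sum_type, ite_apply, hβ]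
    obtain ⟨Z0, hZ0⟩ := hbz
    obtain ⟨J', hJ'⟩ : ∃ J', auxJ A * J' = 1 := by
      obtain ⟨B, hB⟩ := hA.exists_right_inv
      refine ⟨fromBlocks 0 (-B.map (starRingEnd ℂ)) B 0, ?_⟩
      rw [auxJ, fromBlocks_multiply, ← fromBlocks_one]
      have : A.map (starRingEnd ℂ) * B.map (starRingEnd ℂ) = 1 := by
        rw [← Matrix.map_mul, hB]; simp
      congr 1 <;> simp [hB, this]
    refine ⟨J' * ((1 - auxJ A) * Z0), ?_⟩
    rw [Matrix.mul_assoc _ (auxJ A), ← Matrix.mul_assoc (auxJ A), hJ', Matrix.one_mul,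
      Matrix.mul_assoc (auxB β), ← Matrix.mul_assoc (auxR A G), r, Matrix.one_mul, hZ0]
  generalize auxB β * auxR A G * auxJ A = Y at *
  generalize auxB β * auxR A1 G1 * auxJ A1 = Y1 at *
  generalize auxB β * auxR A2 G2 * auxJ A2 = Y2 at *
  generalize auxB β * auxR A3 G3 * auxJ A3 = Y3 at *
  have hsum : (S + Φ2 - Φ3) + (T + Φ - Φ2) = (T + Φ1 - Φ3) + (S + Φ - Φ1) := by abel
  have hD : (S + Φ2 - Φ3) + (T + Φ - Φ2) = S + T + Φ - Φ3 := by abel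
  have hE : (S + Φ - Φ1) - (T + Φ - Φ2) = S - T + Φ2 - Φ1 := by abel
  generalize S + Φ - Φ1 = U at *
  generalize T + Φ - Φ2 = V at *
  generalize S + Φ2 - Φ3 = U2 at *
  generalize T + Φ1 - Φ3 = V1 at *
  have comm : (auxX L + auxS N (Complex.I * μ)) * (auxX L + auxS N (Complex.I * ν))
      = (auxX L + auxS N (Complex.I * ν)) * (auxX L + auxS N (Complex.I * μ)) := by
    simp only [auxX, auxS, diagonal_add, diagonal_mul_diagonal]
    congr 1; ext i; rw [mul_comm]
  have cSX : auxX L * (auxX L + auxS N (Complex.I * μ))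
      = (auxX L + auxS N (Complex.I * μ)) * auxX L := by
    rw [mul_add, add_mul, cc]
  have cTX : auxX L * (auxX L + auxS N (Complex.I * ν))
      = (auxX L + auxS N (Complex.I * ν)) * auxX L := by
    rw [mul_add, add_mul, cc]
  have w1 : Y3 * ((auxX L + auxS N (Complex.I * μ)) * (auxX L + auxS N (Complex.I * ν)))
      = U2 * V * Y + (U2 + V) * Y * auxX L + Y * auxX L * auxX L := by
    rw [← Matrix.mul_assoc, l23, Matrix.add_mul, Matrix.mul_assoc U2, l02, Matrix.mul_assoc Y2,
      cTX, ← Matrix.mul_assoc Y2, l02]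
    simp only [Matrix.mul_add, Matrix.add_mul, Matrix.mul_assoc]
    abel
  have w2 : Y3 * ((auxX L + auxS N (Complex.I * ν)) * (auxX L + auxS N (Complex.I * μ)))
      = V1 * U * Y + (V1 + U) * Y * auxX L + Y * auxX L * auxX L := by
    rw [← Matrix.mul_assoc, l13, Matrix.add_mul, Matrix.mul_assoc V1, l01, Matrix.mul_assoc Y1,
      cSX, ← Matrix.mul_assoc Y1, l01]
    simp only [Matrix.mul_add, Matrix.add_mul, Matrix.mul_assoc]
    abel
  rw [comm, w2, hsum] at w1
  have w3 : V1 * U * Y = U2 * V * Y := add_right_cancel (add_right_cancel w1)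
  have hprod : U2 * V = V1 * U := by
    have := congrArg (· * Z) w3
    simp only [Matrix.mul_assoc _ Y Z, hZ, Matrix.mul_one] at this
    exact this.symm
  have q := aux_square U V U2 V1 _ _ (d01.2.trans trS) (d02.2.trans trT)
    (d01.1.trans dS) (d02.1.trans dT) hsum hprod
  refine ⟨?_, ?_, ?_⟩
  · rw [← hD, ← hE]; exact q
  · rw [← hD, trace_add, d23.2, d02.2, trS, trT, add_zero]
  · rw [← hE, trace_sub, d01.2, d02.2, trS, trT, sub_zero]

theorem aux_quat (M : Matrix (Fin 2) (Fin 2) ℂ) (p q : ℂ)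
    (hM : M = !![p, q; -(starRingEnd ℂ) q, (starRingEnd ℂ) p]) (ht : M.trace = 0) :
    M.det = ((q.re ^ 2 + q.im ^ 2 + p.im ^ 2 : ℝ) : ℂ) := by
  subst hM
  have h := congrArg Complex.re ht
  simp [trace_fin_two] at h
  have h' : p.re = 0 := by linarith
  apply Complex.ext <;> simp [det_fin_two, h', pow_two] <;> ring

/-- Proposition 4.1: the `N`-soliton field `φ_{m,n}` built from the Cauchy-like
matrix `A_{jk} = a_k/(conj(L_j) − L_k)`, `A_{m,n} = A·H_μ^m·H_ν^n`, solves the vector lattice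
KdV equation `‖φ_{m+1,n+1} − φ_{m,n}‖·‖φ_{m+1,n} − φ_{m,n+1}‖ = 1`. -/
theorem nsoliton_vector_lattice_KdV (N : ℕ) (hN : 1 ≤ N)
    (L a : Fin N → ℂ) (ha : ∀ k, a k ≠ 0)
    (hL : ∀ j k, starRingEnd ℂ (L j) ≠ L k)
    (A : Matrix (Fin N) (Fin N) ℂ)
    (hA : ∀ j k, A j k = a k / (starRingEnd ℂ (L j) - L k))
    (hAu : IsUnit A)
    (β : Fin N → ℂ) (hβ : β = a ᵥ* A⁻¹)
    (μ ν : ℝ) (hμν : μ ^ 2 ≠ ν ^ 2)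
    (hLμν : ∀ k, L k ≠ Complex.I * μ ∧ L k ≠ -(Complex.I * μ)
        ∧ L k ≠ Complex.I * ν ∧ L k ≠ -(Complex.I * ν))
    (hden : ∀ ζ ∈ ({Complex.I * μ, Complex.I * ν} : Set ℂ),
      1 - β ⬝ᵥ ((Matrix.diagonal (fun k => starRingEnd ℂ (L k)) - ζ • 1)⁻¹
            *ᵥ (fun _ => (1 : ℂ))) ≠ 0
      ∧ 1 - star β ⬝ᵥ ((Matrix.diagonal L + ζ • 1)⁻¹ *ᵥ (fun _ => (1 : ℂ))) ≠ 0)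
    (Amn : ℤ → ℤ → Matrix (Fin N) (Fin N) ℂ)
    (hAmn : ∀ m n : ℤ, Amn m n
        = A * Matrix.diagonal (fun k => ((L k + Complex.I * μ) / (L k - Complex.I * μ)) ^ m)
            * Matrix.diagonal (fun k => ((L k + Complex.I * ν) / (L k - Complex.I * ν)) ^ n))
    (hGmn : ∀ m n : ℤ, IsUnit (1 + Amn m n * (Amn m n).map (starRingEnd ℂ)))
    (φ : ℤ → ℤ → EuclideanSpace ℝ (Fin 3))
    (hφ : ∀ m n : ℤ, φ m n = (WithLp.equiv 2 (Fin 3 → ℝ)).symm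
      ![(β ⬝ᵥ ((1 + Amn m n * (Amn m n).map (starRingEnd ℂ))⁻¹
            *ᵥ (Amn m n *ᵥ (fun _ => (1 : ℂ))))).re / Real.sqrt |μ ^ 2 - ν ^ 2|,
        (β ⬝ᵥ ((1 + Amn m n * (Amn m n).map (starRingEnd ℂ))⁻¹
            *ᵥ (Amn m n *ᵥ (fun _ => (1 : ℂ))))).im / Real.sqrt |μ ^ 2 - ν ^ 2|,
        ((m : ℝ) * μ + (n : ℝ) * ν) / Real.sqrt |μ ^ 2 - ν ^ 2|
          - (β ⬝ᵥ ((1 + Amn m n * (Amn m n).map (starRingEnd ℂ))⁻¹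
              *ᵥ (fun _ => (1 : ℂ)))).im / Real.sqrt |μ ^ 2 - ν ^ 2|]) :
    ∀ m n : ℤ, φ (m + 1) (n + 1) ≠ φ m n → φ (m + 1) n ≠ φ m (n + 1) →
      ‖φ (m + 1) (n + 1) - φ m n‖ * ‖φ (m + 1) n - φ m (n + 1)‖ = 1 := by
  intro m n _ _
  have hden1 : ∀ j k, starRingEnd ℂ (L j) - L k ≠ 0 := fun j k => sub_ne_zero.mpr (hL j k)
  have hβA : β ᵥ* A = a := by
    rw [hβ, vecMul_vecMul, Matrix.nonsing_inv_mul A ((Matrix.isUnit_iff_isUnit_det A).mp hAu),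
      vecMul_one]
  obtain ⟨k₀, hk₀⟩ : ∃ k, β k ≠ 0 := by
    by_contra hcon
    push Not at hcon
    apply ha ⟨0, hN⟩
    rw [← hβA, show β = 0 from funext hcon, zero_vecMul, Pi.zero_apply]
  have hp : ∀ (t : ℝ) k, (t = μ ∨ t = ν) →
      L k - Complex.I * t ≠ 0 ∧ L k + Complex.I * t ≠ 0 := by
    intro t k ht
    obtain ⟨q1, q2, q3, q4⟩ := hLμν k
    rcases ht with rfl | rfl
    · exact ⟨sub_ne_zero.mpr q1, fun h => q2 (eq_neg_of_add_eq_zero_left h)⟩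
    · exact ⟨sub_ne_zero.mpr q3, fun h => q4 (eq_neg_of_add_eq_zero_left h)⟩
  have ent : ∀ m n j k, Amn m n j k = A j k
      * ((L k + Complex.I * μ) / (L k - Complex.I * μ)) ^ m
      * ((L k + Complex.I * ν) / (L k - Complex.I * ν)) ^ n := by
    intro m n j k
    rw [hAmn, mul_diagonal, mul_diagonal]
  have hu : ∀ m n, IsUnit (Amn m n) := by
    intro m n
    rw [hAmn]
    refine (hAu.mul ?_).mul ?_
    · rw [Matrix.isUnit_diagonal, Pi.isUnit_iff]
      intro k
      obtain ⟨q1, q2⟩ := hp μ k (Or.inl rfl)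
      exact (zpow_ne_zero _ (div_ne_zero q2 q1)).isUnit
    · rw [Matrix.isUnit_diagonal, Pi.isUnit_iff]
      intro k
      obtain ⟨q1, q2⟩ := hp ν k (Or.inr rfl)
      exact (zpow_ne_zero _ (div_ne_zero q2 q1)).isUnit
  have hsyl : ∀ m n j k, starRingEnd ℂ (L j) * Amn m n j k - Amn m n j k * L k
      = (β ᵥ* Amn m n) k := by
    intro m n j k
    rw [hAmn, ← vecMul_vecMul, ← vecMul_vecMul, hβA, vecMul_diagonal, vecMul_diagonal,
      mul_diagonal, mul_diagonal, hA]
    have := hden1 j k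
    field_simp
  have hs1 : ∀ m n j k, Amn (m + 1) n j k * (L k - Complex.I * μ)
      = Amn m n j k * (L k + Complex.I * μ) := by
    intro m n j k
    obtain ⟨q1, q2⟩ := hp μ k (Or.inl rfl)
    rw [ent, ent, zpow_add_one₀ (div_ne_zero q2 q1)]
    generalize ((L k + Complex.I * μ) / (L k - Complex.I * μ)) ^ m = x
    field_simp
  have hs2 : ∀ m n j k, Amn m (n + 1) j k * (L k - Complex.I * ν)
      = Amn m n j k * (L k + Complex.I * ν) := by
    intro m n j k
    obtain ⟨q1, q2⟩ := hp ν k (Or.inr rfl)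
    rw [ent, ent, zpow_add_one₀ (div_ne_zero q2 q1)]
    generalize ((L k + Complex.I * ν) / (L k - Complex.I * ν)) ^ n = x
    field_simp
  have hG : ∀ m n, (1 + Amn m n * (Amn m n).map (starRingEnd ℂ))⁻¹
      * (1 + Amn m n * (Amn m n).map (starRingEnd ℂ)) = 1 := fun m n =>
    Matrix.nonsing_inv_mul _ ((Matrix.isUnit_iff_isUnit_det _).mp (hGmn m n))
  obtain ⟨e1, e2, e3⟩ := aux_main L β (fun j => hL j j) k₀ hk₀ μ ν
    (Amn m n) (Amn (m + 1) n) (Amn m (n + 1)) (Amn (m + 1) (n + 1)) _ _ _ _ (hu m n)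
    (hG _ _) (hG _ _) (hG _ _) (hG _ _) (hsyl _ _) (hsyl _ _) (hsyl _ _) (hsyl _ _)
    (hs1 _ _) (hs2 _ _) (hs2 _ _) (hs1 _ _) _ _ _ _ _ _
    (auxPhi _ _ _).symm (auxPhi _ _ _).symm (auxPhi _ _ _).symm (auxPhi _ _ _).symm rfl rfl
  have f00 := hφ m n
  have f10 := hφ (m + 1) n
  have f01 := hφ m (n + 1)
  have f11 := hφ (m + 1) (n + 1)
  have hcpos : 0 < |μ ^ 2 - ν ^ 2| := abs_pos.mpr (sub_ne_zero.mpr hμν)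
  have hc0 : 0 < Real.sqrt |μ ^ 2 - ν ^ 2| := Real.sqrt_pos.mpr hcpos
  have hc2 : Real.sqrt |μ ^ 2 - ν ^ 2| ^ 4 = (μ ^ 2 - ν ^ 2) ^ 2 := by
    rw [show (4 : ℕ) = 2 * 2 from rfl, pow_mul, Real.sq_sqrt hcpos.le, sq_abs]
  generalize Real.sqrt |μ ^ 2 - ν ^ 2| = c at *
  generalize (β ⬝ᵥ ((1 + Amn m n * (Amn m n).map (starRingEnd ℂ))⁻¹
            *ᵥ (Amn m n *ᵥ (fun _ => (1 : ℂ))))) = F at *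
  generalize (β ⬝ᵥ ((1 + Amn m n * (Amn m n).map (starRingEnd ℂ))⁻¹
            *ᵥ (fun _ => (1 : ℂ)))) = K at *
  generalize (β ⬝ᵥ ((1 + Amn (m + 1) n * (Amn (m + 1) n).map (starRingEnd ℂ))⁻¹
            *ᵥ (Amn (m + 1) n *ᵥ (fun _ => (1 : ℂ))))) = F1 at *
  generalize (β ⬝ᵥ ((1 + Amn (m + 1) n * (Amn (m + 1) n).map (starRingEnd ℂ))⁻¹
            *ᵥ (fun _ => (1 : ℂ)))) = K1 at *
  generalize (β ⬝ᵥ ((1 + Amn m (n + 1) * (Amn m (n + 1)).map (starRingEnd ℂ))⁻¹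
            *ᵥ (Amn m (n + 1) *ᵥ (fun _ => (1 : ℂ))))) = F2 at *
  generalize (β ⬝ᵥ ((1 + Amn m (n + 1) * (Amn m (n + 1)).map (starRingEnd ℂ))⁻¹
            *ᵥ (fun _ => (1 : ℂ)))) = K2 at *
  generalize (β ⬝ᵥ ((1 + Amn (m + 1) (n + 1) * (Amn (m + 1) (n + 1)).map (starRingEnd ℂ))⁻¹
            *ᵥ (Amn (m + 1) (n + 1) *ᵥ (fun _ => (1 : ℂ))))) = F3 at *
  generalize (β ⬝ᵥ ((1 + Amn (m + 1) (n + 1) * (Amn (m + 1) (n + 1)).map (starRingEnd ℂ))⁻¹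
            *ᵥ (fun _ => (1 : ℂ)))) = K3 at *
  rw [aux_quat _ (Complex.I * μ + Complex.I * ν + K - K3) (F - F3)
      (by ext i j; fin_cases i <;> fin_cases j <;> simp <;> ring) e2,
    aux_quat _ (Complex.I * μ - Complex.I * ν + K2 - K1) (F2 - F1)
      (by ext i j; fin_cases i <;> fin_cases j <;> simp <;> ring) e3] at e1
  have e4 := congrArg Complex.re e1
  norm_cast at e4
  rw [← hc2] at e4
  simp at e4
  have n1 : ‖φ (m + 1) (n + 1) - φ m n‖ ^ 2 * c ^ 2
      = (F.re - F3.re) ^ 2 + (F.im - F3.im) ^ 2 + (μ + ν + K.im - K3.im) ^ 2 := by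
    rw [f11, f00, EuclideanSpace.norm_sq_eq, Fin.sum_univ_three]
    simp
    field_simp
    ring
  have n2 : ‖φ (m + 1) n - φ m (n + 1)‖ ^ 2 * c ^ 2
      = (F2.re - F1.re) ^ 2 + (F2.im - F1.im) ^ 2 + (μ - ν + K2.im - K1.im) ^ 2 := by
    rw [f10, f01, EuclideanSpace.norm_sq_eq, Fin.sum_univ_three]
    simp
    field_simp
    ring
  rw [← n1, ← n2] at e4
  have hfin : (‖φ (m + 1) (n + 1) - φ m n‖ * ‖φ (m + 1) n - φ m (n + 1)‖) ^ 2 = 1 := by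
    have : c ^ 4 ≠ 0 := by positivity
    apply mul_right_cancel₀ this
    linear_combination e4
  exact (pow_eq_one_iff_of_nonneg (by positivity) two_ne_zero).mp hfin
end
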